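/- arXiv:2512.02001 — 6 statements merged into one kernel-verified Lean document; each statement's English description precedes it below -/
import Mathlib

section
/- There is a constant C > 0 such that the following holds for every odd prime p. Suppose ε ∈ (0,1), ℓ,q ≥ 0 are integers, and 𝓑 = (L,Q) is a quadratic factor on G = 𝔽_p^n of complexity (ℓ,q) and rank at least C(ℓ+q+log_p(ε^(−1))). Then for every atom B of 𝓑, |Ω_B| = (1 ± ε)·p^{4n−4ℓ−7q}, i.e. ||Ω_B| − p^{4n−4ℓ−7q}| ≤ ε·p^{4n−4ℓ−7q}. -/
open scoped BigOperators symmDiff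
open Finset

attribute [local instance] Classical.propDecidable

namespace PaperTS

noncomputable section

/-- The group `𝔽_p^n`, written additively. -/
abbrev Vec (p n : ℕ) := Fin n → ZMod p

/-- Dot product on `𝔽_p^n`. -/
def dot {p n : ℕ} (x y : Vec p n) : ZMod p := ∑ i, x i * y i

/-- A quadratic factor of complexity `(ℓ, q)` on `𝔽_p^n`: a set of `ℓ` linearly independent
vectors together with a set of `q` pairwise distinct symmetric matrices. -/
structure QuadFactor (p n ℓ q : ℕ) where
  L : Fin ℓ → Vec p n
  Q : Fin q → Matrix (Fin n) (Fin n) (ZMod p)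
  linIndep : LinearIndependent (ZMod p) L
  symm : ∀ j, (Q j).IsSymm
  inj : Function.Injective Q

/-- Labels of atoms of a quadratic factor of complexity `(ℓ, q)`. -/
abbrev Label (p ℓ q : ℕ) := (Fin ℓ → ZMod p) × (Fin q → ZMod p)

namespace QuadFactor

variable {p n ℓ q : ℕ}

/-- The linear form `β_L`. -/
def betaL (B : QuadFactor p n ℓ q) (x : Vec p n) : Fin ℓ → ZMod p :=
  fun i => dot x (B.L i)

/-- The bilinear form `β_Q`. -/
def betaQ (B : QuadFactor p n ℓ q) (x y : Vec p n) : Fin q → ZMod p :=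
  fun j => dot x ((B.Q j).mulVec y)

/-- The labelling map `β_𝓑`. -/
def betaB (B : QuadFactor p n ℓ q) (x : Vec p n) : Label p ℓ q :=
  (B.betaL x, B.betaQ x x)

/-- The atom of `B` with label `ab`. -/
def atom (B : QuadFactor p n ℓ q) (ab : Label p ℓ q) : Set (Vec p n) :=
  {x | B.betaB x = ab}

/-- The fibre `β_Q^{-1}(d) ⊆ G × G`. -/
def fibQ (B : QuadFactor p n ℓ q) (d : Fin q → ZMod p) : Set (Vec p n × Vec p n) :=
  {xy | B.betaQ xy.1 xy.2 = d}

/-- The rank of a quadratic factor: `n` if `q = 0`, and otherwise the minimal rank of a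
nontrivial linear combination of the matrices. -/
def rank (B : QuadFactor p n ℓ q) : ℕ :=
  if q = 0 then n
  else sInf ((fun c : Fin q → ZMod p => (∑ j, c j • B.Q j).rank) '' {c | c ≠ 0})

end QuadFactor

/-- Refinement of quadratic factors: every atom of `B'` is contained in an atom of `B`. -/
def Refines {p n ℓ' q' ℓ q : ℕ} (B' : QuadFactor p n ℓ' q') (B : QuadFactor p n ℓ q) : Prop :=
  ∀ ab' : Label p ℓ' q', ∃ ab : Label p ℓ q, B'.atom ab' ⊆ B.atom ab

/-- `Σ(d)` for a tuple of labels `d = (d_a, d_b, d_c, d_ab, d_ac, d_bc)`. -/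
def SigmaD {p ℓ q : ℕ} (da db dc : Label p ℓ q) (dab dac dbc : Fin q → ZMod p) :
    Label p ℓ q :=
  (da.1 + db.1 + dc.1, da.2 + db.2 + dc.2 + 2 • dab + 2 • dac + 2 • dbc)

/-- Real-valued indicator function of a set. -/
def ind1 {G : Type*} (S : Set G) : G → ℝ := S.indicator 1

/-- Density of `A` on `P`. -/
def density {G : Type*} (A P : Set G) : ℝ := ((A ∩ P).ncard : ℝ) / (P.ncard : ℝ)

/-- Sum of `g` over a set in a fintype. -/
def setSum {α : Type*} [Fintype α] (s : Set α) (g : α → ℝ) : ℝ :=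
  ∑ x ∈ Finset.univ.filter (fun x => x ∈ s), g x

/-- Average of `g` over a set in a fintype. -/
def expOver {α : Type*} [Fintype α] (s : Set α) (g : α → ℝ) : ℝ :=
  setSum s g / (s.ncard : ℝ)

/-- The normalized indicator `μ_Γ` of `Γ ⊆ G × G`. -/
def mu {G : Type*} [Fintype G] (Γ : Set (G × G)) (xy : G × G) : ℝ :=
  ((Fintype.card G : ℝ) ^ 2 / (Γ.ncard : ℝ)) * ind1 Γ xy

/-- The product of the 8 values of `f` on the cube generated by `x, h₁, h₂, h₃`. -/
def cubeProd {G : Type*} [AddCommGroup G] (f : G → ℝ) (x h₁ h₂ h₃ : G) : ℝ :=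
  f x * f (x + h₁) * f (x + h₂) * f (x + h₃) * f (x + h₁ + h₂) * f (x + h₁ + h₃) *
    f (x + h₂ + h₃) * f (x + h₁ + h₂ + h₃)

/-- The eighth power of the (unnormalized) `U³` norm. -/
def U3pow8 {G : Type*} [AddCommGroup G] [Fintype G] (f : G → ℝ) : ℝ :=
  ∑ x : G, ∑ h₁ : G, ∑ h₂ : G, ∑ h₃ : G, cubeProd f x h₁ h₂ h₃

/-- The (unnormalized) `U³` norm. -/
def U3norm {G : Type*} [AddCommGroup G] [Fintype G] (f : G → ℝ) : ℝ :=
  U3pow8 f ^ ((1 : ℝ) / 8)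

/-- The Prendiville local `U³` norm of `f` relative to the set `B`
(equal to `0` when `‖1_B‖_{U³} = 0`, by the division-by-zero convention). -/
def U3localP {G : Type*} [AddCommGroup G] [Fintype G] (f : G → ℝ) (B : Set G) : ℝ :=
  U3norm (fun x => f x * ind1 B x) / U3norm (ind1 B)

/-- `Ω_B`: the 4-tuples all of whose associated cube points lie in `B`. -/
def Omega {G : Type*} [AddCommGroup G] (B : Set G) : Set (G × G × G × G) :=
  fun t =>
    match t with
    | (x, h₁, h₂, h₃) =>
        x ∈ B ∧ x + h₁ ∈ B ∧ x + h₂ ∈ B ∧ x + h₃ ∈ B ∧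
        x + h₁ + h₂ ∈ B ∧ x + h₁ + h₃ ∈ B ∧ x + h₂ + h₃ ∈ B ∧ x + h₁ + h₂ + h₃ ∈ B

/-- The change of variables `Ψ : G⁶ → G⁴`. -/
def Psi {G : Type*} [AddCommGroup G] : G × G × G × G × G × G → G × G × G × G :=
  fun t =>
    match t with
    | (x₁, x₂, y₁, y₂, z₁, z₂) => (x₁ + y₁ + z₁, x₂ - x₁, y₂ - y₁, z₂ - z₁)

/-- `K_{2,2,2}(d)`. -/
def K222 {p n ℓ q : ℕ} (B : QuadFactor p n ℓ q) (da db dc : Label p ℓ q)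
    (dab dac dbc : Fin q → ZMod p) :
    Set (Vec p n × Vec p n × Vec p n × Vec p n × Vec p n × Vec p n) :=
  fun t =>
    match t with
    | (x₁, x₂, y₁, y₂, z₁, z₂) =>
        B.betaB x₁ = da ∧ B.betaB x₂ = da ∧ B.betaB y₁ = db ∧ B.betaB y₂ = db ∧
        B.betaB z₁ = dc ∧ B.betaB z₂ = dc ∧
        B.betaQ x₁ y₁ = dab ∧ B.betaQ x₁ y₂ = dab ∧ B.betaQ x₂ y₁ = dab ∧ B.betaQ x₂ y₂ = dab ∧
        B.betaQ x₁ z₁ = dac ∧ B.betaQ x₁ z₂ = dac ∧ B.betaQ x₂ z₁ = dac ∧ B.betaQ x₂ z₂ = dac ∧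
        B.betaQ y₁ z₁ = dbc ∧ B.betaQ y₁ z₂ = dbc ∧ B.betaQ y₂ z₁ = dbc ∧ B.betaQ y₂ z₂ = dbc

/-- The product `∏_{i,j,k ∈ {1,2}} f (x_i + y_j + z_k)` for a 6-tuple. -/
def prod8 {G : Type*} [AddCommGroup G] (f : G → ℝ) :
    G × G × G × G × G × G → ℝ :=
  fun t =>
    match t with
    | (x₁, x₂, y₁, y₂, z₁, z₂) =>
        f (x₁ + y₁ + z₁) * f (x₁ + y₁ + z₂) * f (x₁ + y₂ + z₁) * f (x₁ + y₂ + z₂) *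
        f (x₂ + y₁ + z₁) * f (x₂ + y₁ + z₂) * f (x₂ + y₂ + z₁) * f (x₂ + y₂ + z₂)

/-- The eighth power of the Terry–Wolf local `U³` norm. -/
def TW8 {p n ℓ q : ℕ} [NeZero p] (B : QuadFactor p n ℓ q) (f : Vec p n → ℝ)
    (da db dc : Label p ℓ q) (dab dac dbc : Fin q → ZMod p) : ℝ :=
  expOver (B.atom da) fun x₀ => expOver (B.atom da) fun x₁ =>
  expOver (B.atom db) fun y₀ => expOver (B.atom db) fun y₁ =>
  expOver (B.atom dc) fun z₀ => expOver (B.atom dc) fun z₁ =>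
    (mu (B.fibQ dab) (x₀, y₀) * mu (B.fibQ dab) (x₀, y₁) *
     mu (B.fibQ dab) (x₁, y₀) * mu (B.fibQ dab) (x₁, y₁) *
     mu (B.fibQ dac) (x₀, z₀) * mu (B.fibQ dac) (x₀, z₁) *
     mu (B.fibQ dac) (x₁, z₀) * mu (B.fibQ dac) (x₁, z₁) *
     mu (B.fibQ dbc) (y₀, z₀) * mu (B.fibQ dbc) (y₀, z₁) *
     mu (B.fibQ dbc) (y₁, z₀) * mu (B.fibQ dbc) (y₁, z₁)) *
    prod8 f (x₀, x₁, y₀, y₁, z₀, z₁)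

/-- `A` has VC₂-dimension at least `k`. -/
def HasVC2Dim {G : Type*} [AddCommGroup G] (A : Set G) (k : ℕ) : Prop :=
  ∃ (a b : Fin k → G) (c : Set (Fin k × Fin k) → G),
    ∀ (i j : Fin k) (S : Set (Fin k × Fin k)), (a i + b j + c S ∈ A ↔ (i, j) ∈ S)

/-- `A` has VC₂-dimension at most `k`. -/
def VC2dimLE {G : Type*} [AddCommGroup G] (A : Set G) (k : ℕ) : Prop :=
  ∀ m : ℕ, HasVC2Dim A m → m ≤ k

/-- A growth function: an increasing function `ℝ → ℝ≥0`. -/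
def GrowthFunction (ρ : ℝ → ℝ) : Prop :=
  Monotone ρ ∧ ∀ x, 0 ≤ ρ x

/-- `ρ` is bounded by a polynomial of degree `d` on `[1, ∞)`. -/
def PolyBound (ρ : ℝ → ℝ) (d : ℕ) : Prop :=
  ∃ C > (0 : ℝ), ∀ x : ℝ, 1 ≤ x → ρ x ≤ C * x ^ d

/-- `ρ` is a polynomial growth function of degree (exactly) `d`, i.e. `d ≥ 1` is minimal
with `ρ(x) ≤ C x^d` for `x ≥ 1`. -/
def PolyGrowthDegree (ρ : ℝ → ℝ) (d : ℕ) : Prop :=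
  1 ≤ d ∧ PolyBound ρ d ∧ ∀ d' : ℕ, 1 ≤ d' → PolyBound ρ d' → d ≤ d'

/-- The index `ind(A, 𝒫)` of a partition. -/
def indx {p n : ℕ} (A : Set (Vec p n)) (Ps : Finset (Set (Vec p n))) : ℝ :=
  (∑ P ∈ Ps, density A P ^ 2 * (P.ncard : ℝ)) / (p : ℝ) ^ n

/-- `P` fails to be `δ`-uniform for `A` with respect to the localized `U³` norm. -/
def BadPart {G : Type*} [AddCommGroup G] [Fintype G] (δ : ℝ) (A P : Set G) : Prop :=
  δ * U3norm (ind1 P) < U3norm (fun x => (ind1 A x - density A P) * ind1 P x)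

/-- `ker(U)^⊥`, the orthogonal complement of the kernel of `U`. -/
def kerPerp {p n : ℕ} (U : Matrix (Fin n) (Fin n) (ZMod p)) : Set (Vec p n) :=
  {v | ∀ w : Vec p n, U.mulVec w = 0 → dot v w = 0}

/-- `B'` is a `ρ`-matrix deletion of `B`. -/
def IsMatrixDeletion {p n ℓ' q' ℓ q : ℕ} (ρ : ℝ → ℝ)
    (B' : QuadFactor p n ℓ' q') (B : QuadFactor p n ℓ q) : Prop :=
  q' + 1 = q ∧
  ∃ c : Fin q → ZMod p, c ≠ 0 ∧
    (((∑ j, c j • B.Q j).rank : ℝ) < ρ ((ℓ : ℝ) + (q : ℝ))) ∧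
    (∃ i : Fin q, c i ≠ 0 ∧ Set.range B'.Q = Set.range B.Q \ {B.Q i}) ∧
    Set.range B.L ⊆ Set.range B'.L ∧
    Submodule.span (ZMod p) (Set.range B'.L) =
      Submodule.span (ZMod p) (Set.range B.L ∪ kerPerp (∑ j, c j • B.Q j))

/-- The functions `τ_i^ρ : ℤ × ℤ → ℝ`. -/
def tau (ρ : ℝ → ℝ) : ℕ → ℤ × ℤ → ℝ
  | 0, xy => (xy.1 : ℝ)
  | i + 1, xy => tau ρ i xy + ρ (tau ρ i xy + (xy.2 : ℝ) - (i : ℝ))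

/-- `f_σ^ρ` for binary strings `σ : Fin m → ℤ` (with values in `{-1, 1}`). -/
def fseq (ρ : ℝ → ℝ) : (m : ℕ) → (Fin m → ℤ) → ℝ × ℝ
  | 0, _ => (0, 0)
  | m + 1, σ =>
      let ab := fseq ρ m (fun j => σ j.castSucc)
      if σ (Fin.last m) = 1 then (ab.1 + 1, ab.2 + 1)
      else (ab.1 + ρ (ab.1 + ab.2), ab.2 - 1)

end

section ExponentialSums

open Matrix

variable {p n : ℕ}

/-- The seven independent values determined by a quadratic form on the cube generated by
`x, a, b, c`. -/
def cubeForms (A : Matrix (Fin n) (Fin n) (ZMod p)) (x a b c : Vec p n) : Fin 7 → ZMod p :=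
  ![x ⬝ᵥ A *ᵥ x,
    2 * (x ⬝ᵥ A *ᵥ a) + a ⬝ᵥ A *ᵥ a,
    2 * (x ⬝ᵥ A *ᵥ b) + b ⬝ᵥ A *ᵥ b,
    2 * (x ⬝ᵥ A *ᵥ c) + c ⬝ᵥ A *ᵥ c,
    a ⬝ᵥ A *ᵥ b, a ⬝ᵥ A *ᵥ c, b ⬝ᵥ A *ᵥ c]

/-- A general combination of linear and quadratic values on the cube generated by `x, a, b, c`. -/
def cubePhase (M : Fin 7 → Matrix (Fin n) (Fin n) (ZMod p)) (u : Fin 4 → Vec p n)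
    (x a b c : Vec p n) : ZMod p :=
  ∑ k, ![x, a, b, c] k ⬝ᵥ u k + ∑ k, cubeForms (M k) x a b c k

variable [Fact p.Prime]

theorem sum_stdAddChar_comp_eq_zero {V : Type*} [AddCommGroup V] [Fintype V]
    (f : V →+ ZMod p) (hf : f ≠ 0) : ∑ v, ZMod.stdAddChar (f v) = (0 : ℂ) := by
  refine AddChar.sum_eq_zero_of_ne_one
    (ψ := (ZMod.stdAddChar (N := p)).compAddMonoidHom f) fun h => hf ?_
  ext v
  have h1 : ZMod.stdAddChar (f v) = (1 : ℂ) := by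
    simpa using DFunLike.congr_fun h v
  rw [← AddChar.map_zero_eq_one (ZMod.stdAddChar (N := p))] at h1
  simpa using ZMod.injective_stdAddChar h1

theorem norm_stdAddChar_eq_one (a : ZMod p) : ‖ZMod.stdAddChar a‖ = 1 :=
  AddChar.norm_apply _ _

theorem sum_stdAddChar_dotProduct (w : Vec p n) :
    ∑ x : Vec p n, ZMod.stdAddChar (x ⬝ᵥ w) = if w = 0 then (p : ℂ) ^ n else 0 := by
  split_ifs with hw
  · simp [hw, ZMod.card]
  · refine sum_stdAddChar_comp_eq_zero
      (AddMonoidHom.mk' (fun x : Vec p n => x ⬝ᵥ w) fun x y => add_dotProduct x y w) fun h => hw ?_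
    refine dotProduct_eq_zero w fun x => ?_
    rw [dotProduct_comm]
    exact DFunLike.congr_fun h x

/-- The number of `v` with `Φ v = t`, up to the worst nontrivial exponential sum of `Φ`. -/
theorem abs_card_fiber_sub_le {V ι : Type*} [Fintype V] [Fintype ι] (Φ : V → ι → ZMod p)
    (t : ι → ZMod p) {E : ℝ} (hE : 0 ≤ E)
    (hΦ : ∀ θ : ι → ZMod p, θ ≠ 0 → ‖∑ v, ZMod.stdAddChar (θ ⬝ᵥ Φ v)‖ ≤ E) :
    |(#{v | Φ v = t} : ℝ) - Fintype.card V / (p : ℝ) ^ Fintype.card ι| ≤ E := by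
  have hp : (0 : ℝ) < p := by exact_mod_cast (Fact.out : p.Prime).pos
  have hP : (0 : ℝ) < (p : ℝ) ^ Fintype.card ι := by positivity
  have hcount : ∑ θ : ι → ZMod p, ∑ v, ZMod.stdAddChar (θ ⬝ᵥ (Φ v - t))
      = (#{v | Φ v = t} : ℂ) * (p : ℂ) ^ Fintype.card ι := by
    rw [Finset.sum_comm, Finset.card_filter]
    push_cast
    rw [Finset.sum_mul]
    refine Finset.sum_congr rfl fun v _ => ?_
    by_cases h : Φ v = t
    · simp [h, ZMod.card]
    · rw [if_neg h, zero_mul]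
      refine sum_stdAddChar_comp_eq_zero (AddMonoidHom.mk'
        (fun θ : ι → ZMod p => θ ⬝ᵥ (Φ v - t)) fun x y => add_dotProduct x y _) fun h' => h ?_
      refine sub_eq_zero.1 (dotProduct_eq_zero _ fun x => ?_)
      rw [dotProduct_comm]
      exact DFunLike.congr_fun h' x
  have hterm : ∀ θ : ι → ZMod p, θ ≠ 0 →
      ‖∑ v, ZMod.stdAddChar (θ ⬝ᵥ (Φ v - t))‖ ≤ E := by
    intro θ hθ
    have : ∑ v, ZMod.stdAddChar (θ ⬝ᵥ (Φ v - t))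
        = ZMod.stdAddChar (-(θ ⬝ᵥ t)) * ∑ v, ZMod.stdAddChar (θ ⬝ᵥ Φ v) := by
      rw [Finset.mul_sum]
      refine Finset.sum_congr rfl fun v _ => ?_
      rw [← AddChar.map_add_eq_mul, dotProduct_sub, sub_eq_neg_add]
    rw [this, norm_mul, norm_stdAddChar_eq_one, one_mul]
    exact hΦ θ hθ
  have hsplit : (#{v | Φ v = t} : ℂ) * (p : ℂ) ^ Fintype.card ι - Fintype.card V
      = ∑ θ ∈ univ.erase (0 : ι → ZMod p), ∑ v, ZMod.stdAddChar (θ ⬝ᵥ (Φ v - t)) := by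
    rw [← hcount, ← Finset.add_sum_erase univ _ (Finset.mem_univ (0 : ι → ZMod p))]
    simp
  have hmain : |(#{v | Φ v = t} : ℝ) * (p : ℝ) ^ Fintype.card ι - Fintype.card V|
      ≤ (p : ℝ) ^ Fintype.card ι * E := by
    calc |(#{v | Φ v = t} : ℝ) * (p : ℝ) ^ Fintype.card ι - Fintype.card V|
        = ‖(#{v | Φ v = t} : ℂ) * (p : ℂ) ^ Fintype.card ι - Fintype.card V‖ := by
          rw [← Real.norm_eq_abs, ← Complex.norm_real]
          push_cast
          rfl
      _ ≤ ∑ θ ∈ univ.erase (0 : ι → ZMod p), E := by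
          rw [hsplit]
          exact norm_sum_le_of_le _ fun θ hθ => hterm θ (Finset.ne_of_mem_erase hθ)
      _ ≤ ∑ θ : ι → ZMod p, E :=
          Finset.sum_le_sum_of_subset_of_nonneg (Finset.erase_subset _ _) fun _ _ _ => hE
      _ = _ := by simp [ZMod.card]
  rw [← mul_le_mul_iff_right₀ hP, ← abs_of_pos hP, ← abs_mul, abs_of_pos hP, mul_sub,
    mul_div_cancel₀ _ hP.ne', mul_comm]
  exact hmain

theorem card_mulVec_eq_mul_le (A : Matrix (Fin n) (Fin n) (ZMod p)) (w : Vec p n) :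
    #{h : Vec p n | A *ᵥ h = w} * p ^ A.rank ≤ p ^ n := by
  have hker : #{h : Vec p n | A *ᵥ h = w} ≤ #{h : Vec p n | A *ᵥ h = 0} := by
    rcases Finset.eq_empty_or_nonempty ({h : Vec p n | A *ᵥ h = w} : Finset _) with he | ⟨h₀, h₀w⟩
    · simp [he]
    · simp only [Finset.mem_filter, Finset.mem_univ, true_and] at h₀w
      refine Finset.card_le_card_of_injOn (fun h => h - h₀) (fun h hh => ?_)
        sub_left_injective.injOn
      simp only [Finset.coe_filter, Finset.mem_univ, true_and, Set.mem_ofPred_eq] at hh ⊢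
      rw [mulVec_sub, hh, h₀w, sub_self]
  have hcard : #{h : Vec p n | A *ᵥ h = 0} = p ^ Module.finrank (ZMod p) A.mulVecLin.ker := by
    have h1 := Module.card_eq_pow_finrank (K := ZMod p) (V := A.mulVecLin.ker)
    rw [ZMod.card] at h1
    rw [← h1, Fintype.card_subtype]
    congr 1
    ext h
    simp
  have hrn := A.mulVecLin.finrank_range_add_finrank_ker
  rw [Module.finrank_fin_fun] at hrn
  calc _ ≤ p ^ Module.finrank (ZMod p) A.mulVecLin.ker * p ^ A.rank := by
        rw [← hcard]; gcongr
    _ = p ^ n := by rw [← pow_add, add_comm, Matrix.rank, hrn]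

theorem norm_sum_mul_sum_stdAddChar_le (A : Matrix (Fin n) (Fin n) (ZMod p)) (w : Vec p n)
    (F : Vec p n → ℂ) (hF : ∀ h, ‖F h‖ ≤ 1) :
    ‖∑ h, F h * ∑ x, ZMod.stdAddChar (x ⬝ᵥ (A *ᵥ h + w))‖ * (p : ℝ) ^ A.rank
      ≤ ((p : ℝ) ^ n) ^ 2 := by
  have h1 : ‖∑ h, F h * ∑ x, ZMod.stdAddChar (x ⬝ᵥ (A *ᵥ h + w))‖
      ≤ #{h : Vec p n | A *ᵥ h = -w} * (p : ℝ) ^ n := by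
    calc _ ≤ ∑ h, if A *ᵥ h = -w then (p : ℝ) ^ n else 0 := by
          refine norm_sum_le_of_le _ fun h _ => ?_
          rw [sum_stdAddChar_dotProduct]
          simp only [add_eq_zero_iff_eq_neg]
          split_ifs
          · rw [norm_mul, norm_pow, Complex.norm_natCast]
            exact mul_le_of_le_one_left (by positivity) (hF h)
          · simp
      _ = _ := by simp [← Finset.sum_filter]
  have h2 : (#{h : Vec p n | A *ᵥ h = -w} : ℝ) * (p : ℝ) ^ A.rank ≤ (p : ℝ) ^ n := by
    exact_mod_cast card_mulVec_eq_mul_le A (-w)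
  calc _ ≤ #{h : Vec p n | A *ᵥ h = -w} * (p : ℝ) ^ n * (p : ℝ) ^ A.rank := by gcongr
    _ = (#{h : Vec p n | A *ᵥ h = -w} * (p : ℝ) ^ A.rank) * (p : ℝ) ^ n := by ring
    _ ≤ (p : ℝ) ^ n * (p : ℝ) ^ n := by gcongr
    _ = _ := by ring

theorem dotProduct_mulVec_comm_of_isSymm {A : Matrix (Fin n) (Fin n) (ZMod p)} (hA : A.IsSymm)
    (x y : Vec p n) : x ⬝ᵥ A *ᵥ y = y ⬝ᵥ A *ᵥ x := by
  rw [dotProduct_mulVec, ← mulVec_transpose, hA.eq, dotProduct_comm]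

/-- Gauss sum bound for a quadratic form in odd characteristic. -/
theorem norm_sum_quadratic_sq_mul_le (hp2 : (2 : ZMod p) ≠ 0) {A : Matrix (Fin n) (Fin n) (ZMod p)}
    (hA : A.IsSymm) (u : Vec p n) :
    ‖∑ x, ZMod.stdAddChar (x ⬝ᵥ A *ᵥ x + x ⬝ᵥ u)‖ ^ 2 * (p : ℝ) ^ A.rank ≤ ((p : ℝ) ^ n) ^ 2 := by
  have hrank : ((2 : ZMod p) • A).rank = A.rank :=
    Matrix.rank_smul_of_mem_nonZeroDivisors A (mem_nonZeroDivisors_of_ne_zero hp2)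
  have key : ((‖∑ x, ZMod.stdAddChar (x ⬝ᵥ A *ᵥ x + x ⬝ᵥ u)‖ ^ 2 : ℝ) : ℂ)
      = ∑ h, ZMod.stdAddChar (h ⬝ᵥ A *ᵥ h + h ⬝ᵥ u)
          * ∑ x, ZMod.stdAddChar (x ⬝ᵥ (((2 : ZMod p) • A) *ᵥ h + 0)) := by
    push_cast
    rw [← Complex.conj_mul', map_sum, Finset.sum_mul_sum]
    simp_rw [Finset.mul_sum]
    conv_rhs => rw [Finset.sum_comm]
    refine Finset.sum_congr rfl fun x _ => ?_
    rw [← Equiv.sum_comp (Equiv.addLeft x)]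
    refine Finset.sum_congr rfl fun h _ => ?_
    rw [← AddChar.map_neg_eq_conj, ← AddChar.map_add_eq_mul, ← AddChar.map_add_eq_mul]
    congr 1
    simp only [Equiv.coe_addLeft, mulVec_add, add_dotProduct, dotProduct_add, smul_mulVec,
      dotProduct_smul, smul_eq_mul, dotProduct_mulVec_comm_of_isSymm hA h x, add_zero]
    ring
  have := norm_sum_mul_sum_stdAddChar_le ((2 : ZMod p) • A) 0
    (fun h => ZMod.stdAddChar (h ⬝ᵥ A *ᵥ h + h ⬝ᵥ u)) fun h => (norm_stdAddChar_eq_one _).le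
  rw [← key, hrank, Complex.norm_real, Real.norm_of_nonneg (by positivity)] at this
  exact this

theorem norm_sum_bilinear_mul_le (A : Matrix (Fin n) (Fin n) (ZMod p)) (u : Vec p n)
    (F : Vec p n → ZMod p) :
    ‖∑ x, ∑ y, ZMod.stdAddChar (x ⬝ᵥ A *ᵥ y + x ⬝ᵥ u + F y)‖ * (p : ℝ) ^ A.rank
      ≤ ((p : ℝ) ^ n) ^ 2 := by
  have := norm_sum_mul_sum_stdAddChar_le A u
    (fun y => ZMod.stdAddChar (F y)) fun h => (norm_stdAddChar_eq_one _).le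
  rw [Finset.sum_comm]
  convert this using 5 with y
  rw [Finset.mul_sum]
  refine Finset.sum_congr rfl fun x _ => ?_
  rw [← AddChar.map_add_eq_mul, dotProduct_add]
  congr 1
  ring

variable {δ : ℝ} {R : ℕ}

theorem norm_sum_quadratic_le (hp2 : (2 : ZMod p) ≠ 0) (hδ : 0 ≤ δ) (hδR : δ ^ 2 * (p : ℝ) ^ R = 1)
    {A : Matrix (Fin n) (Fin n) (ZMod p)} (hA : A.IsSymm) (hR : R ≤ A.rank)
    {g : Vec p n → ZMod p} (u : Vec p n) (c : ZMod p)
    (hg : ∀ x, g x = x ⬝ᵥ A *ᵥ x + x ⬝ᵥ u + c) :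
    ‖∑ x, ZMod.stdAddChar (g x)‖ ≤ (p : ℝ) ^ n * δ := by
  have hp : (1 : ℝ) ≤ p := by exact_mod_cast (Fact.out : p.Prime).one_le
  have h1 : ∑ x, ZMod.stdAddChar (g x)
      = ZMod.stdAddChar c * ∑ x, ZMod.stdAddChar (x ⬝ᵥ A *ᵥ x + x ⬝ᵥ u) := by
    rw [Finset.mul_sum]
    refine Finset.sum_congr rfl fun x _ => ?_
    rw [hg, ← AddChar.map_add_eq_mul, add_comm]
  rw [h1, norm_mul, norm_stdAddChar_eq_one, one_mul]
  refine le_of_sq_le_sq ?_ (by positivity)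
  have hpos : (0 : ℝ) < (p : ℝ) ^ R := by positivity
  refine le_of_mul_le_mul_right ?_ hpos
  calc _ ≤ ‖∑ x, ZMod.stdAddChar (x ⬝ᵥ A *ᵥ x + x ⬝ᵥ u)‖ ^ 2 * (p : ℝ) ^ A.rank := by gcongr
    _ ≤ ((p : ℝ) ^ n) ^ 2 := norm_sum_quadratic_sq_mul_le hp2 hA u
    _ = _ := by rw [mul_pow, mul_assoc, hδR, mul_one]

theorem norm_sum_bilinear_le (hδ : 0 ≤ δ) (hδR : δ ^ 2 * (p : ℝ) ^ R = 1)
    {A : Matrix (Fin n) (Fin n) (ZMod p)} (hR : R ≤ A.rank)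
    {g : Vec p n → Vec p n → ZMod p} (u : Vec p n) (F : Vec p n → ZMod p)
    (hg : ∀ x y, g x y = x ⬝ᵥ A *ᵥ y + x ⬝ᵥ u + F y) :
    ‖∑ x, ∑ y, ZMod.stdAddChar (g x y)‖ ≤ ((p : ℝ) ^ n) ^ 2 * δ := by
  have hp : (1 : ℝ) ≤ p := by exact_mod_cast (Fact.out : p.Prime).one_le
  have hpos : (1 : ℝ) ≤ (p : ℝ) ^ R := one_le_pow₀ hp
  have hδ1 : δ ≤ 1 := by
    by_contra! h
    nlinarith
  simp_rw [hg]
  refine le_of_mul_le_mul_right ?_ (zero_lt_one.trans_le hpos)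
  calc _ ≤ ‖∑ x, ∑ y, ZMod.stdAddChar (x ⬝ᵥ A *ᵥ y + x ⬝ᵥ u + F y)‖ * (p : ℝ) ^ A.rank := by
        gcongr
    _ ≤ ((p : ℝ) ^ n) ^ 2 * 1 := by rw [mul_one]; exact norm_sum_bilinear_mul_le A u F
    _ = ((p : ℝ) ^ n) ^ 2 * (δ * δ * (p : ℝ) ^ R) := by rw [← sq, hδR]
    _ ≤ ((p : ℝ) ^ n) ^ 2 * (δ * 1 * (p : ℝ) ^ R) := by gcongr
    _ = _ := by ring

theorem norm_sum_vec_le {f : Vec p n → ℂ} {E : ℝ} (hf : ∀ x, ‖f x‖ ≤ E) :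
    ‖∑ x, f x‖ ≤ (p : ℝ) ^ n * E := by
  calc _ ≤ ∑ x : Vec p n, E := norm_sum_le_of_le _ fun x _ => hf x
    _ = _ := by simp [ZMod.card]

theorem cubePhase_eq (M : Fin 7 → Matrix (Fin n) (Fin n) (ZMod p)) (u : Fin 4 → Vec p n)
    (x a b c : Vec p n) :
    cubePhase M u x a b c = x ⬝ᵥ u 0 + a ⬝ᵥ u 1 + b ⬝ᵥ u 2 + c ⬝ᵥ u 3 +
      (x ⬝ᵥ M 0 *ᵥ x + (2 * (x ⬝ᵥ M 1 *ᵥ a) + a ⬝ᵥ M 1 *ᵥ a)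
        + (2 * (x ⬝ᵥ M 2 *ᵥ b) + b ⬝ᵥ M 2 *ᵥ b) + (2 * (x ⬝ᵥ M 3 *ᵥ c) + c ⬝ᵥ M 3 *ᵥ c)
        + a ⬝ᵥ M 4 *ᵥ b + a ⬝ᵥ M 5 *ᵥ c + b ⬝ᵥ M 6 *ᵥ c) := by
  simp [cubePhase, cubeForms, Fin.sum_univ_seven, Fin.sum_univ_four]

theorem norm_sum_cubePhase_le (hp2 : (2 : ZMod p) ≠ 0) (hδ : 0 ≤ δ)
    (hδR : δ ^ 2 * (p : ℝ) ^ R = 1) {M : Fin 7 → Matrix (Fin n) (Fin n) (ZMod p)}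
    (hM : ∀ k, (M k).IsSymm) (hrank : ∀ k, M k = 0 ∨ R ≤ (M k).rank)
    (hex : ∃ k, R ≤ (M k).rank) (u : Fin 4 → Vec p n) :
    ‖∑ x, ∑ a, ∑ b, ∑ c, ZMod.stdAddChar (cubePhase M u x a b c)‖ ≤ ((p : ℝ) ^ n) ^ 4 * δ := by
  have hs := fun k => dotProduct_mulVec_comm_of_isSymm (hM k)
  have swap : ∀ f : Vec p n → Vec p n → ℂ, ∑ x, ∑ y, f x y = ∑ y, ∑ x, f x y :=
    fun f => Finset.sum_comm
  have swap₂₃ : ∀ f : Vec p n → Vec p n → Vec p n → Vec p n → ℂ,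
      ∑ x, ∑ a, ∑ b, ∑ c, f x a b c = ∑ x, ∑ b, ∑ a, ∑ c, f x a b c :=
    fun f => Finset.sum_congr rfl fun x _ => swap fun a b => ∑ c, f x a b c
  have swap₃₄ : ∀ f : Vec p n → Vec p n → Vec p n → Vec p n → ℂ,
      ∑ x, ∑ a, ∑ b, ∑ c, f x a b c = ∑ x, ∑ a, ∑ c, ∑ b, f x a b c :=
    fun f => Finset.sum_congr rfl fun x _ => Finset.sum_congr rfl fun a _ => swap (f x a)
  have rot1 : ∀ f : Vec p n → Vec p n → Vec p n → Vec p n → ℂ,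
      ∑ x, ∑ a, ∑ b, ∑ c, f x a b c = ∑ x, ∑ b, ∑ c, ∑ a, f x a b c :=
    fun f => (swap₂₃ f).trans (swap₃₄ fun x b a c => f x a b c)
  have rot4 : ∀ f : Vec p n → Vec p n → Vec p n → Vec p n → ℂ,
      ∑ x, ∑ a, ∑ b, ∑ c, f x a b c = ∑ x, ∑ c, ∑ a, ∑ b, f x a b c :=
    fun f => (swap₃₄ f).trans (swap₂₃ fun x a c b => f x a b c)
  have rot0 : ∀ f : Vec p n → Vec p n → Vec p n → Vec p n → ℂ,
      ∑ x, ∑ a, ∑ b, ∑ c, f x a b c = ∑ a, ∑ b, ∑ c, ∑ x, f x a b c :=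
    fun f => (swap fun x a => ∑ b, ∑ c, f x a b c).trans (rot1 fun a x b c => f x a b c)
  have quad : ∀ (k : Fin 7) (hk : R ≤ (M k).rank) {g : Vec p n → Vec p n → Vec p n → Vec p n →
      ZMod p} (w : Vec p n → Vec p n → Vec p n → Vec p n) (d : Vec p n → Vec p n → Vec p n → ZMod p),
      (∀ x y z t, g x y z t = t ⬝ᵥ M k *ᵥ t + t ⬝ᵥ w x y z + d x y z) →
      ‖∑ x, ∑ y, ∑ z, ∑ t, ZMod.stdAddChar (g x y z t)‖ ≤ ((p : ℝ) ^ n) ^ 4 * δ := by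
    intro k hk g w d hg
    refine (norm_sum_vec_le fun x => norm_sum_vec_le fun y => norm_sum_vec_le fun z =>
      norm_sum_quadratic_le hp2 hδ hδR (hM k) hk (w x y z) (d x y z) (hg x y z)).trans_eq ?_
    ring
  have bilin : ∀ (k : Fin 7) (hk : R ≤ (M k).rank) {g : Vec p n → Vec p n → Vec p n → Vec p n →
      ZMod p} (w : Vec p n → Vec p n → Vec p n) (d : Vec p n → Vec p n → Vec p n → ZMod p),
      (∀ x y z t, g x y z t = z ⬝ᵥ M k *ᵥ t + z ⬝ᵥ w x y + d x y t) →
      ‖∑ x, ∑ y, ∑ z, ∑ t, ZMod.stdAddChar (g x y z t)‖ ≤ ((p : ℝ) ^ n) ^ 4 * δ := by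
    intro k hk g w d hg
    refine (norm_sum_vec_le fun x => norm_sum_vec_le fun y =>
      norm_sum_bilinear_le hδ hδR hk (w x y) (d x y) (hg x y)).trans_eq ?_
    ring
  have case0 : R ≤ (M 0).rank → ‖∑ x, ∑ a, ∑ b, ∑ c, ZMod.stdAddChar (cubePhase M u x a b c)‖
      ≤ ((p : ℝ) ^ n) ^ 4 * δ := by
    intro hk
    rw [rot0]
    refine quad 0 hk (fun a b c => u 0 + (2 : ZMod p) • (M 1 *ᵥ a + M 2 *ᵥ b + M 3 *ᵥ c))
      (fun a b c => cubePhase M u 0 a b c) fun a b c x => ?_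
    simp only [cubePhase_eq, dotProduct_add, dotProduct_smul, smul_eq_mul, zero_dotProduct]
    ring
  have case1 : R ≤ (M 1).rank → ‖∑ x, ∑ a, ∑ b, ∑ c, ZMod.stdAddChar (cubePhase M u x a b c)‖
      ≤ ((p : ℝ) ^ n) ^ 4 * δ := by
    intro hk
    rw [rot1]
    refine quad 1 hk (fun x b c => u 1 + (2 : ZMod p) • (M 1 *ᵥ x) + M 4 *ᵥ b + M 5 *ᵥ c)
      (fun x b c => cubePhase M u x 0 b c) fun x b c a => ?_
    simp only [cubePhase_eq, dotProduct_add, dotProduct_smul, smul_eq_mul, zero_dotProduct,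
      mulVec_zero, dotProduct_zero, hs 1 a x]
    ring
  have case2 : R ≤ (M 2).rank → ‖∑ x, ∑ a, ∑ b, ∑ c, ZMod.stdAddChar (cubePhase M u x a b c)‖
      ≤ ((p : ℝ) ^ n) ^ 4 * δ := by
    intro hk
    rw [swap₃₄]
    refine quad 2 hk (fun x a c => u 2 + (2 : ZMod p) • (M 2 *ᵥ x) + M 4 *ᵥ a + M 6 *ᵥ c)
      (fun x a c => cubePhase M u x a 0 c) fun x a c b => ?_
    simp only [cubePhase_eq, dotProduct_add, dotProduct_smul, smul_eq_mul, zero_dotProduct,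
      mulVec_zero, dotProduct_zero, hs 2 b x, hs 4 b a]
    ring
  have case3 : R ≤ (M 3).rank → ‖∑ x, ∑ a, ∑ b, ∑ c, ZMod.stdAddChar (cubePhase M u x a b c)‖
      ≤ ((p : ℝ) ^ n) ^ 4 * δ := by
    intro hk
    refine quad 3 hk (fun x a b => u 3 + (2 : ZMod p) • (M 3 *ᵥ x) + M 5 *ᵥ a + M 6 *ᵥ b)
      (fun x a b => cubePhase M u x a b 0) fun x a b c => ?_
    simp only [cubePhase_eq, dotProduct_add, dotProduct_smul, smul_eq_mul, zero_dotProduct,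
      mulVec_zero, dotProduct_zero, hs 3 c x, hs 5 c a, hs 6 c b]
    ring
  have case4 : R ≤ (M 4).rank → ‖∑ x, ∑ a, ∑ b, ∑ c, ZMod.stdAddChar (cubePhase M u x a b c)‖
      ≤ ((p : ℝ) ^ n) ^ 4 * δ := by
    intro hk
    refine (hrank 1).elim (fun h1 => ?_) case1
    rw [rot4]
    refine bilin 4 hk (fun x c => u 1 + M 5 *ᵥ c) (fun x c b => cubePhase M u x 0 b c)
      fun x c a b => ?_
    simp only [cubePhase_eq, dotProduct_add, zero_dotProduct, h1, zero_mulVec,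
      mulVec_zero, dotProduct_zero]
    ring
  have case5 : R ≤ (M 5).rank → ‖∑ x, ∑ a, ∑ b, ∑ c, ZMod.stdAddChar (cubePhase M u x a b c)‖
      ≤ ((p : ℝ) ^ n) ^ 4 * δ := by
    intro hk
    refine (hrank 1).elim (fun h1 => ?_) case1
    rw [swap₂₃]
    refine bilin 5 hk (fun x b => u 1 + M 4 *ᵥ b) (fun x b c => cubePhase M u x 0 b c)
      fun x b a c => ?_
    simp only [cubePhase_eq, dotProduct_add, zero_dotProduct, h1, zero_mulVec,
      mulVec_zero, dotProduct_zero]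
    ring
  have case6 : R ≤ (M 6).rank → ‖∑ x, ∑ a, ∑ b, ∑ c, ZMod.stdAddChar (cubePhase M u x a b c)‖
      ≤ ((p : ℝ) ^ n) ^ 4 * δ := by
    intro hk
    refine (hrank 2).elim (fun h2 => ?_) case2
    refine bilin 6 hk (fun x a => u 2 + M 4 *ᵥ a) (fun x a c => cubePhase M u x a 0 c)
      fun x a b c => ?_
    simp only [cubePhase_eq, dotProduct_add, zero_dotProduct, h2, zero_mulVec,
      mulVec_zero, dotProduct_zero, hs 4 b a]
    ring
  obtain ⟨k, hk⟩ := hex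
  fin_cases k
  exacts [case0 hk, case1 hk, case2 hk, case3 hk, case4 hk, case5 hk, case6 hk]

theorem sum_cubePhase_linear_eq_zero {u : Fin 4 → Vec p n} (hu : u ≠ 0) :
    ∑ v : Vec p n × Vec p n × Vec p n × Vec p n,
      ZMod.stdAddChar (cubePhase 0 u v.1 v.2.1 v.2.2.1 v.2.2.2) = (0 : ℂ) := by
  refine sum_stdAddChar_comp_eq_zero (AddMonoidHom.mk'
    (fun v : Vec p n × Vec p n × Vec p n × Vec p n =>
      cubePhase 0 u v.1 v.2.1 v.2.2.1 v.2.2.2) fun v w => ?_) fun h => hu ?_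
  · simp only [cubePhase_eq, Pi.zero_apply, zero_mulVec, dotProduct_zero, Prod.fst_add,
      Prod.snd_add, add_dotProduct]
    ring
  · have h' := fun v => DFunLike.congr_fun h v
    simp only [AddMonoidHom.mk'_apply, cubePhase_eq, Pi.zero_apply, zero_mulVec, dotProduct_zero,
      AddMonoidHom.zero_apply, mul_zero, add_zero] at h'
    ext1 k
    refine dotProduct_eq_zero _ fun x => ?_
    rw [dotProduct_comm]
    fin_cases k
    · simpa using h' (x, 0, 0, 0)
    · simpa using h' (0, x, 0, 0)
    · simpa using h' (0, 0, x, 0)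
    · simpa using h' (0, 0, 0, x)

theorem cubeForms_sum_smul {κ : Type*} [Fintype κ] (θ : κ → ZMod p)
    (Q : κ → Matrix (Fin n) (Fin n) (ZMod p)) (x a b c : Vec p n) (k : Fin 7) :
    cubeForms (∑ j, θ j • Q j) x a b c k = ∑ j, θ j * cubeForms (Q j) x a b c k := by
  have h : ∀ y z : Vec p n, y ⬝ᵥ (∑ j, θ j • Q j) *ᵥ z = ∑ j, θ j * (y ⬝ᵥ Q j *ᵥ z) := by
    intro y z
    rw [sum_mulVec, dotProduct_sum]
    simp [smul_mulVec]
  fin_cases k <;>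
    simp [cubeForms, h, mul_add, Finset.sum_add_distrib, Finset.mul_sum, mul_left_comm]

end ExponentialSums

namespace QuadFactor

open Matrix

variable {p n ℓ q : ℕ}

/-- The linear and quadratic values of the factor on a cube, as a single vector. -/
def cubeMap (B : QuadFactor p n ℓ q) (v : Vec p n × Vec p n × Vec p n × Vec p n) :
    (Fin 4 × Fin ℓ) ⊕ (Fin 7 × Fin q) → ZMod p :=
  Sum.elim (fun ki => ![v.1, v.2.1, v.2.2.1, v.2.2.2] ki.1 ⬝ᵥ B.L ki.2)
    fun kj => cubeForms (B.Q kj.2) v.1 v.2.1 v.2.2.1 v.2.2.2 kj.1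

theorem dotProduct_cubeMap (B : QuadFactor p n ℓ q) [Fact p.Prime]
    (θ : (Fin 4 × Fin ℓ) ⊕ (Fin 7 × Fin q) → ZMod p)
    (v : Vec p n × Vec p n × Vec p n × Vec p n) :
    θ ⬝ᵥ B.cubeMap v = cubePhase (fun k => ∑ j, θ (Sum.inr (k, j)) • B.Q j)
      (fun k => ∑ i, θ (Sum.inl (k, i)) • B.L i) v.1 v.2.1 v.2.2.1 v.2.2.2 := by
  simp only [cubePhase, cubeForms_sum_smul, dotProduct_sum, dotProduct_smul, smul_eq_mul]
  rw [dotProduct, Fintype.sum_sum_type, Fintype.sum_prod_type, Fintype.sum_prod_type]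
  rfl

/-- The value of `cubeMap` on the cubes contained in the atom with label `ab`. -/
def cubeTarget (ab : Label p ℓ q) : (Fin 4 × Fin ℓ) ⊕ (Fin 7 × Fin q) → ZMod p :=
  Sum.elim (fun ki => if ki.1 = 0 then ab.1 ki.2 else 0)
    fun kj => if kj.1 = 0 then ab.2 kj.2 else 0

theorem mem_omega_atom_iff (B : QuadFactor p n ℓ q) [Fact p.Prime] (hp2 : (2 : ZMod p) ≠ 0)
    (ab : Label p ℓ q) (v : Vec p n × Vec p n × Vec p n × Vec p n) :
    v ∈ Omega (B.atom ab) ↔ B.cubeMap v = cubeTarget ab := by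
  obtain ⟨x, a, b, c⟩ := v
  have hatom : ∀ y, y ∈ B.atom ab ↔
      (∀ i, y ⬝ᵥ B.L i = ab.1 i) ∧ ∀ j, y ⬝ᵥ B.Q j *ᵥ y = ab.2 j := by
    intro y
    simp only [atom, betaB, Set.mem_ofPred_eq, Prod.ext_iff, funext_iff]
    rfl
  have hR : B.cubeMap (x, a, b, c) = cubeTarget ab ↔
      (∀ i, x ⬝ᵥ B.L i = ab.1 i ∧ a ⬝ᵥ B.L i = 0 ∧ b ⬝ᵥ B.L i = 0 ∧ c ⬝ᵥ B.L i = 0) ∧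
      ∀ j, x ⬝ᵥ B.Q j *ᵥ x = ab.2 j ∧
        2 * (x ⬝ᵥ B.Q j *ᵥ a) + a ⬝ᵥ B.Q j *ᵥ a = 0 ∧
        2 * (x ⬝ᵥ B.Q j *ᵥ b) + b ⬝ᵥ B.Q j *ᵥ b = 0 ∧
        2 * (x ⬝ᵥ B.Q j *ᵥ c) + c ⬝ᵥ B.Q j *ᵥ c = 0 ∧
        a ⬝ᵥ B.Q j *ᵥ b = 0 ∧ a ⬝ᵥ B.Q j *ᵥ c = 0 ∧ b ⬝ᵥ B.Q j *ᵥ c = 0 := by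
    simp only [funext_iff, Sum.forall, Prod.forall, cubeMap, cubeTarget, Sum.elim_inl,
      Sum.elim_inr, Fin.forall_fin_succ, cubeForms, forall_and]
    simp [and_assoc]
  have hL : (x, a, b, c) ∈ Omega (B.atom ab) ↔
      x ∈ B.atom ab ∧ x + a ∈ B.atom ab ∧ x + b ∈ B.atom ab ∧ x + c ∈ B.atom ab ∧
        x + a + b ∈ B.atom ab ∧ x + a + c ∈ B.atom ab ∧ x + b + c ∈ B.atom ab ∧
        x + a + b + c ∈ B.atom ab := Iff.rfl
  rw [hR, hL]
  simp only [hatom]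
  constructor
  · rintro ⟨⟨l0, q0⟩, ⟨l1, q1⟩, ⟨l2, q2⟩, ⟨l3, q3⟩, ⟨-, q12⟩, ⟨-, q13⟩, ⟨-, q23⟩, -⟩
    refine ⟨fun i => ?_, fun j => ?_⟩
    · specialize l0 i; specialize l1 i; specialize l2 i; specialize l3 i
      rw [add_dotProduct, l0, add_eq_left] at l1 l2 l3
      exact ⟨l0, l1, l2, l3⟩
    · have hs := dotProduct_mulVec_comm_of_isSymm (B.symm j)
      specialize q0 j; specialize q1 j; specialize q2 j; specialize q3 j
      specialize q12 j; specialize q13 j; specialize q23 j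
      simp only [mulVec_add, dotProduct_add, add_dotProduct, hs a x, hs b x, hs c x, hs b a,
        hs c a, hs c b] at q1 q2 q3 q12 q13 q23
      refine ⟨q0, by linear_combination q1 - q0, by linear_combination q2 - q0,
        by linear_combination q3 - q0, mul_left_cancel₀ hp2 ?_, mul_left_cancel₀ hp2 ?_,
        mul_left_cancel₀ hp2 ?_⟩
      · linear_combination q12 - q1 - q2 + q0
      · linear_combination q13 - q1 - q3 + q0
      · linear_combination q23 - q2 - q3 + q0
  · rintro ⟨hl, hq⟩
    have key : ∀ r s t : ZMod p, (r = 0 ∨ r = 1) → (s = 0 ∨ s = 1) → (t = 0 ∨ t = 1) →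
        (∀ i, (x + r • a + s • b + t • c) ⬝ᵥ B.L i = ab.1 i) ∧
        ∀ j, (x + r • a + s • b + t • c) ⬝ᵥ B.Q j *ᵥ (x + r • a + s • b + t • c) = ab.2 j := by
      intro r s t hr hs ht
      refine ⟨fun i => ?_, fun j => ?_⟩
      · obtain ⟨h0, h1, h2, h3⟩ := hl i
        simp [add_dotProduct, h0, h1, h2, h3]
      · have hc := dotProduct_mulVec_comm_of_isSymm (B.symm j)
        obtain ⟨h0, h1, h2, h3, h4, h5, h6⟩ := hq j
        have hr2 : r * r = r := by rcases hr with rfl | rfl <;> simp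
        have hs2 : s * s = s := by rcases hs with rfl | rfl <;> simp
        have ht2 : t * t = t := by rcases ht with rfl | rfl <;> simp
        simp only [mulVec_add, mulVec_smul, dotProduct_add, add_dotProduct, smul_dotProduct,
          dotProduct_smul, smul_eq_mul, hc a x, hc b x, hc c x, hc b a, hc c a, hc c b, h4, h5, h6]
        linear_combination h0 + r * h1 + s * h2 + t * h3 + (a ⬝ᵥ B.Q j *ᵥ a) * hr2
          + (b ⬝ᵥ B.Q j *ᵥ b) * hs2 + (c ⬝ᵥ B.Q j *ᵥ c) * ht2
    refine ⟨?_, ?_, ?_, ?_, ?_, ?_, ?_, ?_⟩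
    · simpa using key 0 0 0 (by simp) (by simp) (by simp)
    · simpa using key 1 0 0 (by simp) (by simp) (by simp)
    · simpa using key 0 1 0 (by simp) (by simp) (by simp)
    · simpa using key 0 0 1 (by simp) (by simp) (by simp)
    · simpa using key 1 1 0 (by simp) (by simp) (by simp)
    · simpa using key 1 0 1 (by simp) (by simp) (by simp)
    · simpa using key 0 1 1 (by simp) (by simp) (by simp)
    · simpa using key 1 1 1 (by simp) (by simp) (by simp)

theorem rank_le_rank_sum_smul (B : QuadFactor p n ℓ q) {c : Fin q → ZMod p} (hc : c ≠ 0) :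
    B.rank ≤ (∑ j, c j • B.Q j).rank := by
  have hq : q ≠ 0 := by
    rintro rfl
    exact hc (Subsingleton.elim _ _)
  rw [rank, if_neg hq]
  exact Nat.sInf_le ⟨c, hc, rfl⟩

theorem norm_sum_cubeMap_le (B : QuadFactor p n ℓ q) [Fact p.Prime] (hp2 : (2 : ZMod p) ≠ 0)
    {δ : ℝ} (hδ : 0 ≤ δ) (hδR : δ ^ 2 * (p : ℝ) ^ B.rank = 1)
    {θ : (Fin 4 × Fin ℓ) ⊕ (Fin 7 × Fin q) → ZMod p} (hθ : θ ≠ 0) :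
    ‖∑ v, ZMod.stdAddChar (θ ⬝ᵥ B.cubeMap v)‖ ≤ ((p : ℝ) ^ n) ^ 4 * δ := by
  simp_rw [dotProduct_cubeMap]
  by_cases hQ : ∀ k, (fun j => θ (Sum.inr (k, j))) = 0
  · have hM : (fun k => ∑ j, θ (Sum.inr (k, j)) • B.Q j) = 0 := by
      ext1 k
      exact Finset.sum_eq_zero fun j _ => by rw [show θ (Sum.inr (k, j)) = 0 from
        congrFun (hQ k) j, zero_smul]
    rw [hM, sum_cubePhase_linear_eq_zero, norm_zero]
    · positivity
    · intro hu
      refine hθ (funext ?_)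
      rintro (⟨k, i⟩ | ⟨k, j⟩)
      · exact Fintype.linearIndependent_iff.1 B.linIndep _ (congrFun hu k) i
      · exact congrFun (hQ k) j
  · push Not at hQ
    obtain ⟨k, hk⟩ := hQ
    have h := norm_sum_cubePhase_le (M := fun k => ∑ j, θ (Sum.inr (k, j)) • B.Q j) hp2 hδ hδR
      (fun k => ?_) (fun k => ?_) ⟨k, B.rank_le_rank_sum_smul hk⟩
      (fun k => ∑ i, θ (Sum.inl (k, i)) • B.L i)
    · simpa only [Fintype.sum_prod_type] using h
    · rw [IsSymm, transpose_sum]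
      exact Finset.sum_congr rfl fun j _ => by rw [transpose_smul, (B.symm j).eq]
    · by_cases h : (fun j => θ (Sum.inr (k, j))) = 0
      · left
        exact Finset.sum_eq_zero fun j _ => by rw [show θ (Sum.inr (k, j)) = 0 from
          congrFun h j, zero_smul]
      · exact Or.inr (B.rank_le_rank_sum_smul h)

theorem abs_ncard_omega_atom_sub_le (B : QuadFactor p n ℓ q) [Fact p.Prime]
    (hp2 : (2 : ZMod p) ≠ 0) {δ : ℝ} (hδ : 0 ≤ δ) (hδR : δ ^ 2 * (p : ℝ) ^ B.rank = 1)
    (ab : Label p ℓ q) :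
    |((Omega (B.atom ab)).ncard : ℝ) - ((p : ℝ) ^ n) ^ 4 / (p : ℝ) ^ (4 * ℓ + 7 * q)|
      ≤ ((p : ℝ) ^ n) ^ 4 * δ := by
  have h := abs_card_fiber_sub_le B.cubeMap (cubeTarget ab) (by positivity)
    fun θ => B.norm_sum_cubeMap_le hp2 hδ hδR
  have hcard : (Omega (B.atom ab)).ncard = #{v | B.cubeMap v = cubeTarget ab} := by
    rw [← Set.ncard_coe_finset]
    congr 1
    ext v
    simp [B.mem_omega_atom_iff hp2]
  have hV : (Fintype.card (Vec p n × Vec p n × Vec p n × Vec p n) : ℝ) = ((p : ℝ) ^ n) ^ 4 := by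
    simp only [Fintype.card_prod, Fintype.card_pi, ZMod.card, Finset.prod_const, Finset.card_univ,
      Fintype.card_fin]
    push_cast
    ring
  rw [hV, ← hcard] at h
  simpa using h

end QuadFactor

theorem statement8 :
    ∃ C > (0 : ℝ), ∀ (p : ℕ), p.Prime → Odd p →
      ∀ ε : ℝ, 0 < ε → ε < 1 →
      ∀ (n ℓ q : ℕ) (B : QuadFactor p n ℓ q),
        C * ((ℓ : ℝ) + (q : ℝ) + Real.logb p ε⁻¹) ≤ (B.rank : ℝ) →
        ∀ ab : Label p ℓ q,
          |((Omega (B.atom ab)).ncard : ℝ) -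
              (p : ℝ) ^ (4 * (n : ℤ) - 4 * (ℓ : ℤ) - 7 * (q : ℤ))| ≤
            ε * (p : ℝ) ^ (4 * (n : ℤ) - 4 * (ℓ : ℤ) - 7 * (q : ℤ)) := by
  refine ⟨14, by norm_num, fun p hp hodd ε hε hε1 n ℓ q B hrank ab => ?_⟩
  have : Fact p.Prime := ⟨hp⟩
  have hp2 : (2 : ZMod p) ≠ 0 := by
    intro h
    have h2 : p ∣ 2 := (ZMod.natCast_eq_zero_iff 2 p).1 (by exact_mod_cast h)
    rw [(Nat.prime_dvd_prime_iff_eq hp Nat.prime_two).1 h2] at hodd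
    exact absurd hodd (by decide)
  have hp0 : (0 : ℝ) < p := by exact_mod_cast hp.pos
  have hp1 : (1 : ℝ) < p := by exact_mod_cast hp.one_lt
  set δ : ℝ := (p : ℝ) ^ (-(B.rank : ℝ) / 2) with hδ
  have hδR : δ ^ 2 * (p : ℝ) ^ B.rank = 1 := by
    rw [hδ, ← Real.rpow_natCast, ← Real.rpow_natCast, ← Real.rpow_mul hp0.le, ← Real.rpow_add hp0]
    convert Real.rpow_zero _ using 2
    push_cast
    ring
  have hlog : 0 ≤ Real.logb p ε⁻¹ :=
    Real.logb_nonneg hp1 ((one_le_inv₀ hε).2 hε1.le)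
  have hδε : δ ≤ ε / (p : ℝ) ^ (4 * ℓ + 7 * q) := by
    have h1 : ε = (p : ℝ) ^ (-Real.logb p ε⁻¹) := by
      rw [Real.logb_inv, neg_neg, Real.rpow_logb hp0 hp1.ne' hε]
    calc δ ≤ (p : ℝ) ^ (-Real.logb p ε⁻¹ - ((4 * ℓ + 7 * q : ℕ) : ℝ)) := by
          refine Real.rpow_le_rpow_of_exponent_le hp1.le ?_
          have : (0 : ℝ) ≤ ℓ := ℓ.cast_nonneg
          push_cast
          linarith
      _ = ε / (p : ℝ) ^ (4 * ℓ + 7 * q) := by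
          rw [Real.rpow_sub hp0, ← h1, Real.rpow_natCast]
  have hmain : (p : ℝ) ^ (4 * (n : ℤ) - 4 * (ℓ : ℤ) - 7 * (q : ℤ))
      = ((p : ℝ) ^ n) ^ 4 / (p : ℝ) ^ (4 * ℓ + 7 * q) := by
    rw [sub_sub, zpow_sub₀ hp0.ne', ← pow_mul, mul_comm n 4]
    norm_cast
  rw [hmain]
  refine (B.abs_ncard_omega_atom_sub_le hp2 (Real.rpow_nonneg hp0.le _) hδR ab).trans ?_
  calc ((p : ℝ) ^ n) ^ 4 * δ ≤ ((p : ℝ) ^ n) ^ 4 * (ε / (p : ℝ) ^ (4 * ℓ + 7 * q)) := by gcongr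
    _ = _ := by ring

end PaperTS
end

section
/- Let p be an odd prime, let r ≥ 0 be a real number, let ℓ,q ≥ 0 be integers, and let 𝓑 = (L,Q) be a quadratic factor on G = 𝔽_p^n of complexity (ℓ,q) and rank at least r. Then the number of 4-tuples (w_1,w_2,w_3,w_4) ∈ G⁴ such that the set of vectors L ∪ {Mw_1, Mw_2, Mw_3, Mw_4 : M ∈ Q} is not linearly independent is at most 14·p^{4n+ℓ+4q−r}. -/
open scoped BigOperators symmDiff
open Finset

attribute [local instance] Classical.propDecidable

namespace PaperTS

/-- A subset of a fibre of a linear map on a finite space has at most `|V| / |range φ|`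
elements. -/
theorem card_fiber_mul_le {p : ℕ} [Fact p.Prime] {V W : Type*} [AddCommGroup V]
    [Module (ZMod p) V] [Fintype V] [AddCommGroup W] [Module (ZMod p) W]
    (φ : V →ₗ[ZMod p] W) {b : W} {s : Finset V} (hs : ∀ v ∈ s, φ v = b) {R : ℕ}
    (hR : R ≤ Module.finrank (ZMod p) φ.range) :
    s.card * p ^ R ≤ Fintype.card V := by
  have hp : 0 < p := (Fact.out : p.Prime).pos
  have hV : Fintype.card V = p ^ Module.finrank (ZMod p) V := by
    rw [Module.card_eq_pow_finrank (K := ZMod p), ZMod.card]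
  have hker : s.card ≤ p ^ Module.finrank (ZMod p) φ.ker := by
    have hk : Fintype.card φ.ker = p ^ Module.finrank (ZMod p) φ.ker := by
      rw [Module.card_eq_pow_finrank (K := ZMod p), ZMod.card]
    rw [← hk]
    rcases s.eq_empty_or_nonempty with h | ⟨v₀, hv₀⟩
    · simp [h]
    · rw [← Finset.card_univ]
      have hmem : ∀ v ∈ s, v - v₀ ∈ φ.ker := by
        intro v hv
        simp [LinearMap.mem_ker, hs v hv, hs v₀ hv₀]
      exact Finset.card_le_card_of_injOn
        (fun v => if h : v - v₀ ∈ φ.ker then ⟨v - v₀, h⟩ else 0) (by simp)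
        (fun v hv w hw h => by simpa [hmem v hv, hmem w hw] using h)
  calc _ ≤ p ^ Module.finrank (ZMod p) φ.ker * p ^ Module.finrank (ZMod p) φ.range :=
        Nat.mul_le_mul hker (Nat.pow_le_pow_right hp hR)
    _ = Fintype.card V := by
        rw [hV, ← pow_add, add_comm, LinearMap.finrank_range_add_finrank_ker]

/-- The rank of a factor bounds from below the rank of each nontrivial combination of its
matrices. -/
theorem QuadFactor.rank_le {p n ℓ q : ℕ} (B : QuadFactor p n ℓ q) {c : Fin q → ZMod p}
    (hc : c ≠ 0) : B.rank ≤ (∑ j, c j • B.Q j).rank := by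
  have hq : q ≠ 0 := by
    rintro rfl
    exact hc (Subsingleton.elim _ _)
  rw [QuadFactor.rank, if_neg hq]
  exact Nat.sInf_le ⟨c, hc, rfl⟩

/-- The linear map `w ↦ ∑ i, ∑ j, c i j • Q j w i`. -/
def QuadFactor.combMap {p n ℓ q k : ℕ} (B : QuadFactor p n ℓ q) (c : Fin k → Fin q → ZMod p) :
    (Fin k → Vec p n) →ₗ[ZMod p] Vec p n :=
  ∑ i, (∑ j, c i j • B.Q j).mulVecLin ∘ₗ LinearMap.proj i

theorem QuadFactor.combMap_apply {p n ℓ q k : ℕ} (B : QuadFactor p n ℓ q)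
    (c : Fin k → Fin q → ZMod p) (w : Fin k → Vec p n) :
    B.combMap c w = ∑ i, ∑ j, c i j • (B.Q j).mulVec (w i) := by
  simp only [combMap, LinearMap.sum_apply, LinearMap.comp_apply, LinearMap.proj_apply,
    Matrix.mulVecLin_apply, Matrix.sum_mulVec, Matrix.smul_mulVec]

theorem QuadFactor.rank_le_finrank_range_combMap {p n ℓ q k : ℕ} [Fact p.Prime]
    (B : QuadFactor p n ℓ q) {c : Fin k → Fin q → ZMod p} (hc : c ≠ 0) :
    B.rank ≤ Module.finrank (ZMod p) (B.combMap c).range := by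
  obtain ⟨i, hi⟩ := Function.ne_iff.mp hc
  refine (B.rank_le hi).trans (Submodule.finrank_mono ?_)
  rintro _ ⟨v, rfl⟩
  refine ⟨Pi.single i v, ?_⟩
  rw [combMap, LinearMap.sum_apply, Finset.sum_eq_single i]
  · simp
  · intro b _ hb
    simp [Pi.single_eq_of_ne hb]
  · simp

/-- The family consisting of the linear part of `B` and the images of the `w i` under the
matrices of `B`. -/
def QuadFactor.vecFamily {p n ℓ q k : ℕ} (B : QuadFactor p n ℓ q) (w : Fin k → Vec p n) :
    Fin ℓ ⊕ Fin k × Fin q → Vec p n :=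
  Sum.elim B.L fun x => (B.Q x.2).mulVec (w x.1)

theorem QuadFactor.exists_combMap_eq {p n ℓ q k : ℕ} [Fact p.Prime] (B : QuadFactor p n ℓ q)
    {w : Fin k → Vec p n} (hw : ¬ LinearIndependent (ZMod p) (B.vecFamily w)) :
    ∃ (a : Fin ℓ → ZMod p) (c : Fin k → Fin q → ZMod p), c ≠ 0 ∧
      B.combMap c w = ∑ i, a i • B.L i := by
  obtain ⟨g, hg, hne⟩ := Fintype.not_linearIndependent_iff.mp hw
  simp only [vecFamily, Fintype.sum_sum_type, Sum.elim_inl, Sum.elim_inr,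
    Fintype.sum_prod_type] at hg
  refine ⟨fun i => - g (.inl i), fun i j => g (.inr (i, j)), ?_, ?_⟩
  · intro h0
    have hr : ∀ i j, g (.inr (i, j)) = 0 := fun i j => congrFun (congrFun h0 i) j
    have hl : ∀ i, g (.inl i) = 0 := by
      simp only [hr, zero_smul, sum_const_zero, add_zero] at hg
      exact Fintype.linearIndependent_iff.mp B.linIndep _ hg
    obtain ⟨x | ⟨i, j⟩, hx⟩ := hne
    · exact hx (hl x)
    · exact hx (hr i j)
  · rw [combMap_apply]
    simp only [neg_smul, sum_neg_distrib]
    exact eq_neg_of_add_eq_zero_right hg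

theorem QuadFactor.card_not_linearIndependent_vecFamily_mul_le {p n ℓ q k : ℕ} [Fact p.Prime]
    (B : QuadFactor p n ℓ q) :
    (univ.filter fun w : Fin k → Vec p n =>
        ¬ LinearIndependent (ZMod p) (B.vecFamily w)).card * p ^ B.rank
      ≤ p ^ (k * n + ℓ + k * q) := by
  let S := univ.filter fun x : (Fin ℓ → ZMod p) × (Fin k → Fin q → ZMod p) => x.2 ≠ 0
  let F := fun x : (Fin ℓ → ZMod p) × (Fin k → Fin q → ZMod p) =>
    univ.filter fun w : Fin k → Vec p n => B.combMap x.2 w = ∑ i, x.1 i • B.L i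
  have hsub : (univ.filter fun w : Fin k → Vec p n =>
      ¬ LinearIndependent (ZMod p) (B.vecFamily w)) ⊆ S.biUnion F := by
    intro w hw
    obtain ⟨a, c, hc, h⟩ := B.exists_combMap_eq (mem_filter.mp hw).2
    exact mem_biUnion.mpr ⟨(a, c), by simpa [S] using hc, by simpa [F] using h⟩
  have hS : S.card ≤ p ^ (ℓ + k * q) := by
    refine (card_filter_le _ _).trans_eq ?_
    simp only [card_univ, Fintype.card_prod, Fintype.card_pi, ZMod.card, prod_const,
      Fintype.card_fin]
    ring
  have hF : ∀ x ∈ S, (F x).card * p ^ B.rank ≤ p ^ (k * n) := by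
    intro x hx
    refine (card_fiber_mul_le (B.combMap x.2) (fun w hw => (mem_filter.mp hw).2)
      (B.rank_le_finrank_range_combMap (mem_filter.mp hx).2)).trans_eq ?_
    simp only [Fintype.card_pi, ZMod.card, prod_const, card_univ, Fintype.card_fin]
    ring
  calc _ ≤ (∑ x ∈ S, (F x).card) * p ^ B.rank :=
        Nat.mul_le_mul_right _ ((card_le_card hsub).trans card_biUnion_le)
    _ = ∑ x ∈ S, (F x).card * p ^ B.rank := Finset.sum_mul ..
    _ ≤ S.card * p ^ (k * n) := by simpa using Finset.sum_le_card_nsmul S _ _ hF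
    _ ≤ p ^ (ℓ + k * q) * p ^ (k * n) := Nat.mul_le_mul_right _ hS
    _ = p ^ (k * n + ℓ + k * q) := by ring

theorem statement9 (p n ℓ q : ℕ) (hp : p.Prime) (hodd : Odd p)
    (r : ℝ) (hr : 0 ≤ r) (B : QuadFactor p n ℓ q) (hrank : r ≤ (B.rank : ℝ)) :
    (({w : Vec p n × Vec p n × Vec p n × Vec p n |
        ¬ LinearIndependent (ZMod p)
          (fun v : ↥(Set.range B.L ∪
              ⋃ j : Fin q, ({(B.Q j).mulVec w.1, (B.Q j).mulVec w.2.1,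
                (B.Q j).mulVec w.2.2.1, (B.Q j).mulVec w.2.2.2} : Set (Vec p n))) =>
            (v : Vec p n))}.ncard : ℝ))
      ≤ 14 * (p : ℝ) ^ (4 * (n : ℝ) + (ℓ : ℝ) + 4 * (q : ℝ) - r) := by
  have : Fact p.Prime := ⟨hp⟩
  have hp0 : (0 : ℝ) < p := by exact_mod_cast hp.pos
  have hp1 : (1 : ℝ) ≤ p := by exact_mod_cast hp.one_lt.le
  set N := {w : Vec p n × Vec p n × Vec p n × Vec p n | _}.ncard with hN
  have hle : N ≤ (univ.filter fun w : Fin 4 → Vec p n =>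
      ¬ LinearIndependent (ZMod p) (B.vecFamily w)).card := by
    rw [← Set.ncard_coe_finset]
    refine Set.ncard_le_ncard_of_injOn (fun w => ![w.1, w.2.1, w.2.2.1, w.2.2.2]) ?_ ?_
      (Set.toFinite _)
    · intro w hw
      simp only [Set.mem_ofPred_eq] at hw
      simp only [coe_filter, mem_univ, true_and, Set.mem_ofPred_eq]
      refine fun h => hw ((LinearIndependent.linearIndepOn_id h).mono ?_)
      rintro v (⟨i, rfl⟩ | hv)
      · exact ⟨.inl i, rfl⟩
      · obtain ⟨j, rfl | rfl | rfl | rfl⟩ := Set.mem_iUnion.mp hv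
        exacts [⟨.inr (0, j), rfl⟩, ⟨.inr (1, j), rfl⟩, ⟨.inr (2, j), rfl⟩, ⟨.inr (3, j), rfl⟩]
    · rintro ⟨a, b, c, d⟩ - ⟨a', b', c', d'⟩ - h
      have h0 := congrFun h 0
      have h1 := congrFun h 1
      have h2 := congrFun h 2
      have h3 := congrFun h 3
      simp_all
  have hcount : (N : ℝ) * (p : ℝ) ^ B.rank ≤ (p : ℝ) ^ (4 * n + ℓ + 4 * q) := by
    exact_mod_cast (Nat.mul_le_mul_right _ hle).trans
      B.card_not_linearIndependent_vecFamily_mul_le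
  have hbound : (N : ℝ) ≤ (p : ℝ) ^ (4 * (n : ℝ) + (ℓ : ℝ) + 4 * (q : ℝ) - r) := by
    calc (N : ℝ) ≤ (p : ℝ) ^ (4 * n + ℓ + 4 * q) / (p : ℝ) ^ B.rank :=
          (le_div_iff₀ (pow_pos hp0 _)).mpr hcount
      _ = (p : ℝ) ^ (4 * (n : ℝ) + (ℓ : ℝ) + 4 * (q : ℝ) - (B.rank : ℝ)) := by
          rw [Real.rpow_sub hp0, Real.rpow_natCast, ← Real.rpow_natCast]
          push_cast
          rfl
      _ ≤ _ := Real.rpow_le_rpow_of_exponent_le hp1 (by linarith)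
  have := Real.rpow_nonneg hp0.le (4 * (n : ℝ) + (ℓ : ℝ) + 4 * (q : ℝ) - r)
  linarith

end PaperTS
end

section
/- Let p be an odd prime, let ℓ,q ≥ 0 be integers, let 𝓑 = (L,Q) be a quadratic factor on G = 𝔽_p^n of complexity (ℓ,q), fix e ∈ 𝔽_p^ℓ × 𝔽_p^q and d = (d_a,d_b,d_c,d_{ab},d_{ac},d_{bc}) ∈ (𝔽_p^ℓ × 𝔽_p^q)³ × (𝔽_p^q)³ with Σ(d) = e, and set B = B(e). Then for every (w,h_a,h_b,h_c) ∈ Ω_B one has Ψ^{-1}(w,h_a,h_b,h_c) ∩ K_{2,2,2}(d) = {(x, x+h_a, y, y+h_b, w−x−y, w−x−y+h_c) : x ∈ X, y ∈ Y, β_Q(x,y) = d_{ab}}, where X = {x ∈ B(d_a) : β_Q(x,h_b) = β_Q(x,h_c) = 0, 2β_Q(x,h_a) = −β_Q(h_a,h_a), β_Q(x,w) = d_a + d_{ac} + d_{ab}} and Y = {y ∈ B(d_b) : β_Q(y,h_a) = β_Q(y,h_c) = 0, 2β_Q(y,h_b) = −β_Q(h_b,h_b), β_Q(y,w) = d_b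 + d_{bc} + d_{ab}}. -/
open scoped BigOperators symmDiff
open Finset

attribute [local instance] Classical.propDecidable

namespace PaperTS

theorem dot_eq_dotProduct {p n : ℕ} (x y : Vec p n) : dot x y = x ⬝ᵥ y := rfl

namespace QuadFactor

variable {p n ℓ q : ℕ} (B : QuadFactor p n ℓ q)

theorem betaL_add (x y : Vec p n) : B.betaL (x + y) = B.betaL x + B.betaL y := by
  ext i; simp [betaL, dot_eq_dotProduct, add_dotProduct]

theorem betaL_sub (x y : Vec p n) : B.betaL (x - y) = B.betaL x - B.betaL y := by
  ext i; simp [betaL, dot_eq_dotProduct, sub_dotProduct]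

theorem betaQ_add_left (x y z : Vec p n) : B.betaQ (x + y) z = B.betaQ x z + B.betaQ y z := by
  ext j; simp [betaQ, dot_eq_dotProduct, add_dotProduct]

theorem betaQ_sub_left (x y z : Vec p n) : B.betaQ (x - y) z = B.betaQ x z - B.betaQ y z := by
  ext j; simp [betaQ, dot_eq_dotProduct, sub_dotProduct]

theorem betaQ_add_right (x y z : Vec p n) : B.betaQ x (y + z) = B.betaQ x y + B.betaQ x z := by
  ext j; simp [betaQ, dot_eq_dotProduct, Matrix.mulVec_add, dotProduct_add]

theorem betaQ_sub_right (x y z : Vec p n) : B.betaQ x (y - z) = B.betaQ x y - B.betaQ x z := by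
  ext j; simp [betaQ, dot_eq_dotProduct, Matrix.mulVec_sub, dotProduct_sub]

theorem betaQ_comm (x y : Vec p n) : B.betaQ x y = B.betaQ y x := by
  ext j
  simp only [betaQ, dot_eq_dotProduct]
  rw [Matrix.dotProduct_mulVec, ← Matrix.mulVec_transpose, (B.symm j).eq, dotProduct_comm]

theorem mem_atom {x : Vec p n} {ab : Label p ℓ q} :
    x ∈ B.atom ab ↔ B.betaL x = ab.1 ∧ B.betaQ x x = ab.2 := Prod.ext_iff

end QuadFactor

theorem eq_of_two_mul_eq {p q : ℕ} (hp : p.Prime) (hodd : Odd p) {u v : Fin q → ZMod p}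
    (h : 2 * u = 2 * v) : u = v := by
  have := Fact.mk hp
  have h_two : (2 : ZMod p) ≠ 0 := Ring.two_ne_zero (by
    rw [ZMod.ringChar_zmod_n]; rintro rfl; exact absurd hodd (by decide))
  ext j
  exact mul_left_cancel₀ h_two (congrFun h j)

theorem statement10 (p n ℓ q : ℕ) (hp : p.Prime) (hodd : Odd p)
    (B : QuadFactor p n ℓ q) (e : Label p ℓ q)
    (da db dc : Label p ℓ q) (dab dac dbc : Fin q → ZMod p)
    (hSigma : SigmaD da db dc dab dac dbc = e)
    (w ha hb hc : Vec p n) (hOmega : (w, ha, hb, hc) ∈ Omega (B.atom e)) :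
    Psi ⁻¹' {(w, ha, hb, hc)} ∩ K222 B da db dc dab dac dbc =
      {t | ∃ x ∈ {x | x ∈ B.atom da ∧ B.betaQ x hb = 0 ∧ B.betaQ x hc = 0 ∧
              2 • B.betaQ x ha = - B.betaQ ha ha ∧ B.betaQ x w = da.2 + dac + dab},
           ∃ y ∈ {y | y ∈ B.atom db ∧ B.betaQ y ha = 0 ∧ B.betaQ y hc = 0 ∧
              2 • B.betaQ y hb = - B.betaQ hb hb ∧ B.betaQ y w = db.2 + dbc + dab},
           B.betaQ x y = dab ∧
           t = (x, x + ha, y, y + hb, w - x - y, w - x - y + hc)} := by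
  subst hSigma
  have cancel := fun u v : Fin q → ZMod p => eq_of_two_mul_eq (u := u) (v := v) hp hodd
  obtain ⟨h0, h1, h2, h3, h12, h13, h23, -⟩ := hOmega
  simp only [QuadFactor.mem_atom, SigmaD, B.betaL_add, B.betaQ_add_left, B.betaQ_add_right,
    B.betaQ_comm ha w, B.betaQ_comm hb w, B.betaQ_comm hc w, B.betaQ_comm hb ha,
    B.betaQ_comm hc ha, B.betaQ_comm hc hb, nsmul_eq_mul, Nat.cast_ofNat]
    at h0 h1 h2 h3 h12 h13 h23
  have hLa : B.betaL ha = 0 := by linear_combination h1.1 - h0.1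
  have hLb : B.betaL hb = 0 := by linear_combination h2.1 - h0.1
  have hLc : B.betaL hc = 0 := by linear_combination h3.1 - h0.1
  have hab : B.betaQ ha hb = 0 := cancel _ _ <| by
    linear_combination h12.2 - h1.2 - h2.2 + h0.2
  have hac : B.betaQ ha hc = 0 := cancel _ _ <| by
    linear_combination h13.2 - h1.2 - h3.2 + h0.2
  have hbc : B.betaQ hb hc = 0 := cancel _ _ <| by
    linear_combination h23.2 - h2.2 - h3.2 + h0.2
  have hwa : 2 * B.betaQ w ha = -B.betaQ ha ha := by linear_combination h1.2 - h0.2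
  have hwb : 2 * B.betaQ w hb = -B.betaQ hb hb := by linear_combination h2.2 - h0.2
  have hwc : 2 * B.betaQ w hc = -B.betaQ hc hc := by linear_combination h3.2 - h0.2
  obtain ⟨hLw, hww⟩ := h0
  ext ⟨x, x', y, y', z, z'⟩
  simp only [Set.mem_inter_iff, Set.mem_preimage, Set.mem_singleton_iff, Psi, Prod.mk.injEq,
    Set.mem_ofPred_eq, QuadFactor.mem_atom, nsmul_eq_mul, Nat.cast_ofNat]
  have hK : (x, x', y, y', z, z') ∈ K222 B da db dc dab dac dbc ↔
      (x ∈ B.atom da ∧ x' ∈ B.atom da ∧ y ∈ B.atom db ∧ y' ∈ B.atom db ∧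
        z ∈ B.atom dc ∧ z' ∈ B.atom dc ∧
        B.betaQ x y = dab ∧ B.betaQ x y' = dab ∧ B.betaQ x' y = dab ∧ B.betaQ x' y' = dab ∧
        B.betaQ x z = dac ∧ B.betaQ x z' = dac ∧ B.betaQ x' z = dac ∧ B.betaQ x' z' = dac ∧
        B.betaQ y z = dbc ∧ B.betaQ y z' = dbc ∧ B.betaQ y' z = dbc ∧ B.betaQ y' z' = dbc) :=
    Iff.rfl
  rw [hK]
  simp only [QuadFactor.mem_atom]
  constructor
  · rintro ⟨⟨hw, hx', hy', hz'⟩, hK⟩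
    obtain rfl : x' = x + ha := by rw [← hx']; abel
    obtain rfl : y' = y + hb := by rw [← hy']; abel
    obtain rfl : z = w - x - y := by rw [← hw]; abel
    obtain rfl : z' = w - x - y + hc := by rw [← hz']; abel
    simp only [B.betaQ_add_left, B.betaQ_add_right, B.betaQ_sub_left, B.betaQ_sub_right,
      B.betaQ_comm ha x, B.betaQ_comm ha y, B.betaQ_comm hb y, B.betaQ_comm y x] at hK
    obtain ⟨⟨hxL, hxx⟩, ⟨-, hxx'⟩, ⟨hyL, hyy⟩, ⟨-, hyy'⟩, -, -, xy, xy', x'y, -,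
      xz, xz', -, -, yz, yz', -, -⟩ := hK
    refine ⟨x, ⟨⟨hxL, hxx⟩, ?_, ?_, ?_, ?_⟩, y, ⟨⟨hyL, hyy⟩, ?_, ?_, ?_, ?_⟩, xy,
      rfl, rfl, rfl, rfl, rfl, rfl⟩
    · linear_combination xy' - xy
    · linear_combination xz' - xz
    · linear_combination hxx' - hxx
    · linear_combination xz + hxx + xy
    · linear_combination x'y - xy
    · linear_combination yz' - yz
    · linear_combination hyy' - hyy
    · linear_combination yz + hyy + xy
  · rintro ⟨x, ⟨⟨hxL, hxx⟩, hxb, hxc, hxa, hxw⟩, y, ⟨⟨hyL, hyy⟩, hya, hyc, hyb, hyw⟩, hxy,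
      rfl, rfl, rfl, rfl, rfl, rfl⟩
    have hwxa : B.betaQ w ha = B.betaQ x ha := cancel _ _ (hwa.trans hxa.symm)
    have hwyb : B.betaQ w hb = B.betaQ y hb := cancel _ _ (hwb.trans hyb.symm)
    refine ⟨⟨by abel, by abel, by abel, by abel⟩, ?_⟩
    simp only [B.betaL_add, B.betaL_sub, B.betaQ_add_left, B.betaQ_add_right, B.betaQ_sub_left,
      B.betaQ_sub_right, B.betaQ_comm ha x, B.betaQ_comm ha y, B.betaQ_comm hb y,
      B.betaQ_comm hb x, B.betaQ_comm hc x, B.betaQ_comm hc y, B.betaQ_comm hc w,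
      B.betaQ_comm ha w, B.betaQ_comm hb w, B.betaQ_comm w x, B.betaQ_comm w y,
      B.betaQ_comm y x, hLa, hLb, hLc, hLw, hxL, hyL, hxx, hyy, hxb, hxc, hxw, hya, hyc, hyw,
      hxy, hab, hac, hbc, hwxa, hwyb, hww]
    refine ⟨⟨?_, ?_⟩, ⟨?_, ?_⟩, ⟨?_, ?_⟩, ⟨?_, ?_⟩, ⟨?_, ?_⟩, ⟨?_, ?_⟩, ?_, ?_, ?_, ?_,
      ?_, ?_, ?_, ?_, ?_, ?_, ?_, ?_⟩
    all_goals first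
      | trivial
      | ring1
      | linear_combination hxa
      | linear_combination hyb
      | linear_combination hwc

end PaperTS
end

section
/- There is a constant C = C(p) such that the following holds for every odd prime p. Suppose ε ∈ (0,1), ℓ,q ≥ 0 are integers, 𝓑 = (L,Q) is a quadratic factor on G = 𝔽_p^n of complexity (ℓ,q) and rank at least C(ℓ+q+log_p(ε^(−1))), and d = (d_a,d_b,d_c,d_{ab},d_{ac},d_{bc}) ∈ (𝔽_p^ℓ × 𝔽_p^q)³ × (𝔽_p^q)³. Then for every function f : G → [−1,1], (‖f‖_{U³(d)}^{TW})^8 = (1 ± ε)·p^{−6n+6ℓ+18q}·Σ_{(x_1,x_2,y_1,y_2,z_1,z_2)∈K_{2,2,2}(d)} ∏_{(i,j,k)∈{1,2}³} f(x_i+y_j+z_k). -/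
open scoped BigOperators symmDiff
open Finset

attribute [local instance] Classical.propDecidable

namespace PaperTS

section Fourier

variable {p : ℕ} [Fact p.Prime]

theorem stdAddChar_sum_dotProduct {ι : Type*} [Fintype ι] [DecidableEq ι] (v : ι → ZMod p) :
    ∑ x : ι → ZMod p, ZMod.stdAddChar (x ⬝ᵥ v) =
      if v = 0 then (p : ℂ) ^ Fintype.card ι else 0 := by
  let χ : AddChar (ι → ZMod p) ℂ :=
    ZMod.stdAddChar.compAddMonoidHom ((dotProductBilin (ZMod p) (ZMod p)).flip v).toAddMonoidHom
  have hχ : ∀ x, χ x = ZMod.stdAddChar (x ⬝ᵥ v) := fun x => rfl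
  simp_rw [← hχ]
  split_ifs with h
  · subst h
    simp [hχ, Fintype.card_pi, ZMod.card]
  · obtain ⟨i, hi⟩ := Function.ne_iff.mp h
    refine AddChar.sum_eq_zero_of_ne_one fun hone => ?_
    have h1 := DFunLike.congr_fun hone (Pi.single i (v i)⁻¹)
    rw [hχ, single_dotProduct, inv_mul_cancel₀ hi, AddChar.one_apply,
      ← AddChar.map_zero_eq_one (ZMod.stdAddChar (N := p))] at h1
    exact one_ne_zero (ZMod.injective_stdAddChar h1)

/-- A map to `𝔽_p^ι` all of whose nontrivial exponential sums are small is equidistributed. -/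
theorem abs_ncard_fibre_sub_le {V ι : Type*} [Fintype V] [Fintype ι] (φ : V → ι → ZMod p)
    (d : ι → ZMod p) {E : ℝ} (hE : 0 ≤ E)
    (h : ∀ s : ι → ZMod p, s ≠ 0 → ‖∑ x, ZMod.stdAddChar (s ⬝ᵥ φ x)‖ ≤ E) :
    |({x | φ x = d}.ncard : ℝ) * (p : ℝ) ^ Fintype.card ι - Fintype.card V| ≤
      (p : ℝ) ^ Fintype.card ι * E := by
  have key : (({x | φ x = d}.ncard : ℝ) * (p : ℝ) ^ Fintype.card ι - Fintype.card V : ℂ) =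
      ∑ s ∈ univ.erase (0 : ι → ZMod p), ∑ x, ZMod.stdAddChar (s ⬝ᵥ (φ x - d)) := by
    rw [eq_comm, ← add_right_cancel_iff (a := (Fintype.card V : ℂ)), sub_add_cancel]
    have h0 : ∑ x, ZMod.stdAddChar ((0 : ι → ZMod p) ⬝ᵥ (φ x - d)) = (Fintype.card V : ℂ) := by
      simp
    rw [← h0, Finset.sum_erase_add _ _ (mem_univ _), Finset.sum_comm]
    simp_rw [stdAddChar_sum_dotProduct, sub_eq_zero]
    rw [← Finset.sum_filter, Finset.sum_const, nsmul_eq_mul, Set.ncard_eq_toFinset_card']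
    congr 3
    simp
  rw [← Real.norm_eq_abs, ← Complex.norm_real]
  push_cast
  push_cast at key
  rw [key]
  refine (norm_sum_le _ _).trans ?_
  calc _ ≤ ∑ s ∈ univ.erase (0 : ι → ZMod p), E := by
        refine Finset.sum_le_sum fun s hs => ?_
        refine le_trans (le_of_eq ?_) (h s (Finset.ne_of_mem_erase hs))
        simp_rw [dotProduct_sub, sub_eq_add_neg, AddChar.map_add_eq_mul]
        rw [← Finset.sum_mul, norm_mul, AddChar.norm_apply, mul_one]
    _ ≤ ∑ s : ι → ZMod p, E :=
        Finset.sum_le_sum_of_subset_of_nonneg (Finset.subset_univ _) fun _ _ _ => hE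
    _ = _ := by simp [Fintype.card_pi, ZMod.card]

theorem pow_rank_mul_card_ker {n : ℕ} (M : Matrix (Fin n) (Fin n) (ZMod p)) :
    p ^ M.rank * #{h : Vec p n | M.mulVec h = 0} = p ^ n := by
  have h1 := LinearMap.finrank_range_add_finrank_ker M.mulVecLin
  have h2 := Module.card_eq_pow_finrank (K := ZMod p) (V := LinearMap.ker M.mulVecLin)
  have h3 : #{h : Vec p n | M.mulVec h = 0} = Fintype.card (LinearMap.ker M.mulVecLin) := by
    rw [← Fintype.card_subtype]
    exact Fintype.card_congr (Equiv.subtypeEquivRight fun h => by simp)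
  rw [ZMod.card] at h2
  rw [h3, h2, Matrix.rank, ← pow_add, h1]
  simp

theorem stdAddChar_sum_bilinear {n : ℕ} (M : Matrix (Fin n) (Fin n) (ZMod p)) :
    ∑ y : Vec p n, ∑ x : Vec p n, ZMod.stdAddChar (x ⬝ᵥ M.mulVec y) =
      (p : ℂ) ^ n * #{h : Vec p n | M.mulVec h = 0} := by
  simp_rw [stdAddChar_sum_dotProduct]
  rw [← Finset.sum_filter, Finset.sum_const, nsmul_eq_mul, mul_comm, Fintype.card_fin]

/-- Gauss sum estimate for quadratic phases. -/
theorem norm_sq_stdAddChar_sum_quadratic_le (hodd : Odd p) {n : ℕ}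
    (M : Matrix (Fin n) (Fin n) (ZMod p)) (hM : M.IsSymm) (v : Vec p n) :
    ‖∑ x : Vec p n, ZMod.stdAddChar (x ⬝ᵥ v + x ⬝ᵥ M.mulVec x)‖ ^ 2 ≤
      (p : ℝ) ^ n * #{h : Vec p n | M.mulVec h = 0} := by
  set F : Vec p n → ℂ := fun x => ZMod.stdAddChar (x ⬝ᵥ v + x ⬝ᵥ M.mulVec x) with hF
  have h2 : (2 : ZMod p) ≠ 0 := by
    have : Fact (2 < p) := ⟨by
      have := (Fact.out : p.Prime).two_le
      rcases hodd with ⟨k, rfl⟩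
      omega⟩
    exact Ring.two_ne_zero (by simpa [ZMod.ringChar_zmod_n] using this.out.ne')
  have hterm : ∀ h x : Vec p n, F (x + h) * (starRingEnd ℂ) (F x) =
      F h * ZMod.stdAddChar (x ⬝ᵥ ((2 : ZMod p) • M.mulVec h)) := by
    intro h x
    have hs : h ⬝ᵥ M.mulVec x = x ⬝ᵥ M.mulVec h := by
      rw [Matrix.dotProduct_mulVec, ← Matrix.mulVec_transpose, hM.eq, dotProduct_comm]
    simp only [hF]
    rw [← AddChar.map_neg_eq_conj, ← AddChar.map_add_eq_mul, ← AddChar.map_add_eq_mul]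
    congr 1
    simp only [Matrix.mulVec_add, add_dotProduct, dotProduct_add, dotProduct_smul, hs, smul_eq_mul]
    ring
  have hsq : ((‖∑ x, F x‖ ^ 2 : ℝ) : ℂ) =
      ∑ h, F h * ∑ x : Vec p n, ZMod.stdAddChar (x ⬝ᵥ ((2 : ZMod p) • M.mulVec h)) := by
    push_cast
    rw [← Complex.mul_conj', map_sum, Finset.sum_mul_sum, Finset.sum_comm]
    simp_rw [Finset.mul_sum, ← hterm]
    symm
    rw [Finset.sum_comm]
    refine Finset.sum_congr rfl fun x _ => ?_
    exact Fintype.sum_equiv (Equiv.addLeft x) _ _ fun h => rfl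
  have hnorm : ‖∑ x, F x‖ ^ 2 = ‖((‖∑ x, F x‖ ^ 2 : ℝ) : ℂ)‖ := by
    rw [Complex.norm_real, Real.norm_of_nonneg (by positivity)]
  rw [hnorm, hsq]
  refine (norm_sum_le _ _).trans (le_of_eq ?_)
  simp_rw [norm_mul, hF, AddChar.norm_apply, one_mul, stdAddChar_sum_dotProduct,
    smul_eq_zero, h2, false_or]
  simp_rw [apply_ite norm, norm_zero]
  rw [← Finset.sum_filter, Finset.sum_const, nsmul_eq_mul, mul_comm]
  simp

end Fourier

namespace QuadFactor

variable {p n ℓ q : ℕ} [Fact p.Prime] (B : QuadFactor p n ℓ q)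

theorem dotProduct_betaL (s : Fin ℓ → ZMod p) (x : Vec p n) :
    s ⬝ᵥ B.betaL x = x ⬝ᵥ ∑ i, s i • B.L i := by
  rw [dotProduct_sum]
  exact Finset.sum_congr rfl fun i _ => by rw [dotProduct_smul]; rfl

theorem dotProduct_betaQ (t : Fin q → ZMod p) (x y : Vec p n) :
    t ⬝ᵥ B.betaQ x y = x ⬝ᵥ (∑ j, t j • B.Q j).mulVec y := by
  rw [Matrix.sum_mulVec, dotProduct_sum]
  exact Finset.sum_congr rfl fun i _ => by rw [Matrix.smul_mulVec, dotProduct_smul]; rfl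

theorem rank_le_of_ne_zero {t : Fin q → ZMod p} (ht : t ≠ 0) :
    B.rank ≤ (∑ j, t j • B.Q j).rank := by
  have hq : q ≠ 0 := by
    rintro rfl
    exact ht (Subsingleton.elim _ _)
  rw [rank, if_neg hq]
  exact Nat.sInf_le ⟨t, ht, rfl⟩

theorem card_ker_le {t : Fin q → ZMod p} (ht : t ≠ 0) {D : ℝ} (hD : 0 < D)
    (hr : D ≤ (p : ℝ) ^ B.rank) :
    (#{h : Vec p n | (∑ j, t j • B.Q j).mulVec h = 0} : ℝ) ≤ (p : ℝ) ^ n / D := by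
  have hp : (1 : ℝ) ≤ p := by exact_mod_cast (Fact.out : p.Prime).one_lt.le
  rw [le_div_iff₀ hD]
  have h := pow_rank_mul_card_ker (∑ j, t j • B.Q j)
  rw [← Nat.cast_inj (R := ℝ)] at h
  push_cast at h
  rw [← h, mul_comm]
  gcongr
  exact hr.trans (pow_le_pow_right₀ hp (B.rank_le_of_ne_zero ht))

/-- Atoms of a factor of high rank have about the expected size. -/
theorem abs_ncard_atom_sub_le (hodd : Odd p) (ab : Label p ℓ q) {D : ℝ} (hD : 0 ≤ D)
    (hr : q ≠ 0 → 0 < D ∧ D ^ 2 ≤ (p : ℝ) ^ B.rank) :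
    |((B.atom ab).ncard : ℝ) * (p : ℝ) ^ (ℓ + q) - (p : ℝ) ^ n| ≤
      (p : ℝ) ^ (ℓ + q) * ((p : ℝ) ^ n / D) := by
  have hset : B.atom ab =
      {x | Sum.elim (B.betaL x) (B.betaQ x x) = Sum.elim ab.1 ab.2} := by
    ext x
    simp only [atom, betaB, Set.mem_ofPred_eq, Sum.elim_eq_iff, Prod.ext_iff]
  have hE : (0 : ℝ) ≤ (p : ℝ) ^ n / D := by positivity
  have := abs_ncard_fibre_sub_le (fun x : Vec p n => Sum.elim (B.betaL x) (B.betaQ x x))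
    (Sum.elim ab.1 ab.2) hE ?_
  · rw [hset]
    simpa [ZMod.card] using this
  intro s hs
  have hphase : ∀ x : Vec p n, s ⬝ᵥ Sum.elim (B.betaL x) (B.betaQ x x) =
      x ⬝ᵥ (∑ i, s (Sum.inl i) • B.L i) +
        x ⬝ᵥ (∑ j, s (Sum.inr j) • B.Q j).mulVec x := by
    intro x
    have h1 := B.dotProduct_betaL (s ∘ Sum.inl) x
    have h2 := B.dotProduct_betaQ (s ∘ Sum.inr) x x
    simp only [Function.comp_apply] at h1 h2
    rw [← h1, ← h2]
    simp [dotProduct, Fintype.sum_sum_type]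
  simp_rw [hphase]
  by_cases ht : s ∘ Sum.inr = 0
  · have ht' : ∀ j, s (Sum.inr j) = 0 := fun j => congrFun ht j
    have hL : ∑ i, s (Sum.inl i) • B.L i ≠ 0 := by
      intro h0
      apply hs
      have := Fintype.linearIndependent_iff.mp B.linIndep (fun i => s (Sum.inl i)) h0
      funext i
      rcases i with i | j
      · exact this i
      · exact ht' j
    simp only [ht', zero_smul, Finset.sum_const_zero, Matrix.zero_mulVec, dotProduct_zero, add_zero]
    rw [stdAddChar_sum_dotProduct, if_neg hL, norm_zero]
    exact hE
  · have hq : q ≠ 0 := by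
      rintro rfl
      exact ht (Subsingleton.elim _ _)
    obtain ⟨hDpos, hr⟩ := hr hq
    have hsymm : (∑ j, s (Sum.inr j) • B.Q j).IsSymm := by
      rw [Matrix.IsSymm, Matrix.transpose_sum]
      exact Finset.sum_congr rfl fun j _ => by rw [Matrix.transpose_smul, (B.symm j).eq]
    refine abs_le_of_sq_le_sq' ?_ hE |>.2
    refine (norm_sq_stdAddChar_sum_quadratic_le hodd _ hsymm _).trans ?_
    rw [div_pow, sq ((p : ℝ) ^ n), mul_div_assoc]
    gcongr
    exact B.card_ker_le ht (by positivity) hr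

/-- Fibres of the bilinear map of a factor of high rank have about the expected size. -/
theorem abs_ncard_fibQ_sub_le (d : Fin q → ZMod p) {D : ℝ} (hD : 0 ≤ D)
    (hr : q ≠ 0 → 0 < D ∧ D ≤ (p : ℝ) ^ B.rank) :
    |((B.fibQ d).ncard : ℝ) * (p : ℝ) ^ q - (p : ℝ) ^ (2 * n)| ≤
      (p : ℝ) ^ q * ((p : ℝ) ^ (2 * n) / D) := by
  have hE : (0 : ℝ) ≤ (p : ℝ) ^ (2 * n) / D := by positivity
  have := abs_ncard_fibre_sub_le (fun x : Vec p n × Vec p n => B.betaQ x.1 x.2) d hE ?_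
  · simpa [ZMod.card, fibQ, two_mul, pow_add] using this
  intro s hs
  have hq : q ≠ 0 := by
    rintro rfl
    exact hs (Subsingleton.elim _ _)
  obtain ⟨hDpos, hr⟩ := hr hq
  simp_rw [dotProduct_betaQ]
  rw [Fintype.sum_prod_type, Finset.sum_comm, stdAddChar_sum_bilinear, norm_mul, norm_pow,
    Complex.norm_natCast, Complex.norm_natCast, two_mul, pow_add, mul_div_assoc]
  gcongr
  exact B.card_ker_le hs hDpos hr

end QuadFactor

section Expansion

theorem ind1_of_mem {α : Type*} {s : Set α} {x : α} (h : x ∈ s) : ind1 s x = 1 := by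
  simp [ind1, h]

theorem ind1_ne_zero {α : Type*} {s : Set α} {x : α} : ind1 s x ≠ 0 ↔ x ∈ s := by
  simp [ind1]

theorem setSum_eq_sum_ind1_mul {α : Type*} [Fintype α] (s : Set α) (g : α → ℝ) :
    setSum s g = ∑ x, ind1 s x * g x := by
  simp [setSum, Finset.sum_filter, ind1, Set.indicator_apply]

theorem expOver_eq_sum {α : Type*} [Fintype α] (s : Set α) (g : α → ℝ) :
    expOver s g = ∑ x, (s.ncard : ℝ)⁻¹ * ind1 s x * g x := by
  rw [expOver, setSum_eq_sum_ind1_mul, div_eq_inv_mul, Finset.mul_sum]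
  exact Finset.sum_congr rfl fun x _ => by ring

variable {p n ℓ q : ℕ}

theorem ind1_K222 (B : QuadFactor p n ℓ q) (da db dc : Label p ℓ q)
    (dab dac dbc : Fin q → ZMod p) (x₀ x₁ y₀ y₁ z₀ z₁ : Vec p n) :
    ind1 (K222 B da db dc dab dac dbc) (x₀, x₁, y₀, y₁, z₀, z₁) =
      ind1 (B.atom da) x₀ * ind1 (B.atom da) x₁ * ind1 (B.atom db) y₀ * ind1 (B.atom db) y₁ *
      ind1 (B.atom dc) z₀ * ind1 (B.atom dc) z₁ *
      (ind1 (B.fibQ dab) (x₀, y₀) * ind1 (B.fibQ dab) (x₀, y₁) *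
       ind1 (B.fibQ dab) (x₁, y₀) * ind1 (B.fibQ dab) (x₁, y₁) *
       ind1 (B.fibQ dac) (x₀, z₀) * ind1 (B.fibQ dac) (x₀, z₁) *
       ind1 (B.fibQ dac) (x₁, z₀) * ind1 (B.fibQ dac) (x₁, z₁) *
       ind1 (B.fibQ dbc) (y₀, z₀) * ind1 (B.fibQ dbc) (y₀, z₁) *
       ind1 (B.fibQ dbc) (y₁, z₀) * ind1 (B.fibQ dbc) (y₁, z₁)) := by
  have hiff : (x₀, x₁, y₀, y₁, z₀, z₁) ∈ K222 B da db dc dab dac dbc ↔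
      x₀ ∈ B.atom da ∧ x₁ ∈ B.atom da ∧ y₀ ∈ B.atom db ∧ y₁ ∈ B.atom db ∧
      z₀ ∈ B.atom dc ∧ z₁ ∈ B.atom dc ∧
      (x₀, y₀) ∈ B.fibQ dab ∧ (x₀, y₁) ∈ B.fibQ dab ∧
      (x₁, y₀) ∈ B.fibQ dab ∧ (x₁, y₁) ∈ B.fibQ dab ∧
      (x₀, z₀) ∈ B.fibQ dac ∧ (x₀, z₁) ∈ B.fibQ dac ∧
      (x₁, z₀) ∈ B.fibQ dac ∧ (x₁, z₁) ∈ B.fibQ dac ∧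
      (y₀, z₀) ∈ B.fibQ dbc ∧ (y₀, z₁) ∈ B.fibQ dbc ∧
      (y₁, z₀) ∈ B.fibQ dbc ∧ (y₁, z₁) ∈ B.fibQ dbc := Iff.rfl
  by_cases h : (x₀, x₁, y₀, y₁, z₀, z₁) ∈ K222 B da db dc dab dac dbc
  · rw [ind1_of_mem h]
    obtain ⟨h1, h2, h3, h4, h5, h6, k1, k2, k3, k4, k5, k6, k7, k8, k9, k10, k11, k12⟩ :=
      hiff.mp h
    simp only [ind1_of_mem, *, mul_one]
  · rw [not_not.mp (mt ind1_ne_zero.mp h)]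
    by_contra hne
    apply h
    have hne' := Ne.symm hne
    simp only [mul_ne_zero_iff, ind1_ne_zero] at hne'
    rw [hiff]
    tauto

theorem TW8_eq_mul_setSum [NeZero p] (B : QuadFactor p n ℓ q) (f : Vec p n → ℝ)
    (da db dc : Label p ℓ q) (dab dac dbc : Fin q → ZMod p) :
    TW8 B f da db dc dab dac dbc =
      (((B.atom da).ncard : ℝ)⁻¹ ^ 2 * ((B.atom db).ncard : ℝ)⁻¹ ^ 2 *
        ((B.atom dc).ncard : ℝ)⁻¹ ^ 2 *
        (((p : ℝ) ^ (2 * n) / (B.fibQ dab).ncard) ^ 4 *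
          ((p : ℝ) ^ (2 * n) / (B.fibQ dac).ncard) ^ 4 *
          ((p : ℝ) ^ (2 * n) / (B.fibQ dbc).ncard) ^ 4)) *
      setSum (K222 B da db dc dab dac dbc) (prod8 f) := by
  have hcard : (Fintype.card (Vec p n) : ℝ) ^ 2 = (p : ℝ) ^ (2 * n) := by
    simp [ZMod.card, two_mul, pow_add, sq]
  simp only [TW8, expOver_eq_sum, setSum_eq_sum_ind1_mul, Fintype.sum_prod_type, Finset.mul_sum,
    mu, hcard]
  iterate 6 refine Finset.sum_congr rfl fun _ _ => ?_
  rw [ind1_K222]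
  ring

end Expansion

theorem abs_inv_sub_one_le {ε w : ℝ} (hε : 0 < ε) (hε1 : ε < 1)
    (hl : (1 - ε / 40) ^ 18 ≤ w) (hu : w ≤ (1 + ε / 40) ^ 18) : |w⁻¹ - 1| ≤ ε := by
  have hlow : 1 - 18 * (ε / 40) ≤ (1 - ε / 40) ^ 18 := by
    have := one_add_mul_le_pow (a := -(ε / 40)) (by linarith) 18
    push_cast at this
    rw [← sub_eq_add_neg] at this
    linarith
  have hw : 0 < w := by linarith
  have hprod : (1 - ε / 40) ^ 18 * w ≤ 1 := by
    calc _ ≤ (1 - ε / 40) ^ 18 * (1 + ε / 40) ^ 18 := by gcongr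
      _ = (1 - (ε / 40) ^ 2) ^ 18 := by rw [← mul_pow]; ring
      _ ≤ 1 := pow_le_one₀ (by nlinarith) (by nlinarith)
  rw [abs_le]
  constructor
  · have : (1 - ε / 40) ^ 18 ≤ w⁻¹ := by
      rw [inv_eq_one_div, le_div_iff₀ hw]
      exact hprod
    linarith
  · have : w⁻¹ ≤ 1 + ε := by
      rw [inv_le_comm₀ hw (by linarith), inv_eq_one_div, div_le_iff₀ (by linarith)]
      nlinarith
    linarith

/-- The rank hypothesis turned into the inequality used for the size estimates. -/
theorem sq_le_pow_rank {p : ℕ} (hp : 3 ≤ p) {ε : ℝ} (hε : 0 < ε) (hε1 : ε < 1) {ℓ q r : ℕ}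
    (hq : q ≠ 0) (hr : 10 * ((ℓ : ℝ) + (q : ℝ) + Real.logb p ε⁻¹) ≤ r) :
    ((p : ℝ) ^ (ℓ + q) * (40 / ε)) ^ 2 ≤ (p : ℝ) ^ r := by
  have hp3 : (3 : ℝ) ≤ p := by exact_mod_cast hp
  have hp0 : (0 : ℝ) < p := by linarith
  have hq1 : (1 : ℝ) ≤ q := by exact_mod_cast Nat.one_le_iff_ne_zero.mpr hq
  have hlog : 0 ≤ Real.logb p ε⁻¹ :=
    Real.logb_nonneg (by linarith) ((one_le_inv₀ hε).mpr hε1.le)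
  have heps : ε⁻¹ = (p : ℝ) ^ Real.logb p ε⁻¹ :=
    (Real.rpow_logb hp0 (by linarith) (by positivity)).symm
  have h40 : (40 : ℝ) ≤ (p : ℝ) ^ (4 : ℝ) := by
    calc (40 : ℝ) ≤ 3 ^ (4 : ℕ) := by norm_num
      _ ≤ (p : ℝ) ^ (4 : ℕ) := by gcongr
      _ = _ := by rw [← Real.rpow_natCast]; norm_num
  calc ((p : ℝ) ^ (ℓ + q) * (40 / ε)) ^ 2
      ≤ ((p : ℝ) ^ ((ℓ : ℝ) + q) * ((p : ℝ) ^ (4 : ℝ) * (p : ℝ) ^ Real.logb p ε⁻¹)) ^ 2 := by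
        rw [← heps, div_eq_mul_inv, ← Nat.cast_add, Real.rpow_natCast]
        gcongr
    _ = (p : ℝ) ^ (2 * ((ℓ : ℝ) + q + 4 + Real.logb p ε⁻¹)) := by
        rw [← Real.rpow_add hp0, ← Real.rpow_add hp0, ← Real.rpow_natCast, ← Real.rpow_mul hp0.le]
        congr 1
        push_cast
        ring
    _ ≤ (p : ℝ) ^ (r : ℝ) := by
        refine Real.rpow_le_rpow_of_exponent_le (by linarith) ?_
        have : (0 : ℝ) ≤ ℓ := by positivity
        linarith
    _ = _ := Real.rpow_natCast _ _

theorem mul_div_bounds_of_abs_sub_le {N K X δ : ℝ} (hX : 0 < X)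
    (h : |N * K - X| ≤ δ * X) : 1 - δ ≤ N * K / X ∧ N * K / X ≤ 1 + δ := by
  rw [abs_le] at h
  rw [le_div_iff₀ hX, div_le_iff₀ hX]
  constructor <;> linarith

theorem statement12 (p : ℕ) (hp : p.Prime) (hodd : Odd p) [NeZero p] :
    ∃ C > (0 : ℝ), ∀ ε : ℝ, 0 < ε → ε < 1 →
      ∀ (n ℓ q : ℕ) (B : QuadFactor p n ℓ q),
        C * ((ℓ : ℝ) + (q : ℝ) + Real.logb p ε⁻¹) ≤ (B.rank : ℝ) →
        ∀ (da db dc : Label p ℓ q) (dab dac dbc : Fin q → ZMod p) (f : Vec p n → ℝ),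
          (∀ x, f x ∈ Set.Icc (-1 : ℝ) 1) →
          |TW8 B f da db dc dab dac dbc -
              (p : ℝ) ^ (6 * (ℓ : ℤ) + 18 * (q : ℤ) - 6 * (n : ℤ)) *
                setSum (K222 B da db dc dab dac dbc) (prod8 f)| ≤
            ε * |(p : ℝ) ^ (6 * (ℓ : ℤ) + 18 * (q : ℤ) - 6 * (n : ℤ)) *
                setSum (K222 B da db dc dab dac dbc) (prod8 f)| := by
  have : Fact p.Prime := ⟨hp⟩
  have hp3 : 3 ≤ p := by
    have := hp.two_le
    rcases hodd with ⟨k, rfl⟩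
    omega
  have hp0 : (0 : ℝ) < p := by positivity
  refine ⟨10, by norm_num, fun ε hε hε1 n ℓ q B hrank da db dc dab dac dbc f _ => ?_⟩
  -- For `q = 0` the sizes are exact: the choice `D = 0` makes the error term `_ / D` vanish.
  obtain ⟨hatom, hfib⟩ :
      (∀ ab, |((B.atom ab).ncard : ℝ) * (p : ℝ) ^ (ℓ + q) - (p : ℝ) ^ n| ≤
        ε / 40 * (p : ℝ) ^ n) ∧
      (∀ d, |((B.fibQ d).ncard : ℝ) * (p : ℝ) ^ q - (p : ℝ) ^ (2 * n)| ≤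
        ε / 40 * (p : ℝ) ^ (2 * n)) := by
    by_cases hq : q = 0
    · refine ⟨fun ab => (B.abs_ncard_atom_sub_le hodd ab le_rfl fun h => absurd hq h).trans ?_,
        fun d => (B.abs_ncard_fibQ_sub_le d le_rfl fun h => absurd hq h).trans ?_⟩ <;>
      · rw [div_zero, mul_zero]
        positivity
    · set D : ℝ := (p : ℝ) ^ (ℓ + q) * (40 / ε) with hD
      have hDpos : 0 < D := by positivity
      have hD2 : D ^ 2 ≤ (p : ℝ) ^ B.rank := sq_le_pow_rank hp3 hε hε1 hq hrank
      have hp1 : (1 : ℝ) ≤ p := by exact_mod_cast hp.one_lt.le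
      have hD1 : 1 ≤ D := by
        refine one_le_mul_of_one_le_of_one_le (one_le_pow₀ hp1) ?_
        rw [le_div_iff₀ hε]
        linarith
      constructor
      · intro ab
        refine (B.abs_ncard_atom_sub_le hodd ab hDpos.le fun _ => ⟨hDpos, hD2⟩).trans
          (le_of_eq ?_)
        rw [hD]
        field_simp
      · intro d
        refine (B.abs_ncard_fibQ_sub_le d hDpos.le fun _ => ⟨hDpos, by nlinarith⟩).trans ?_
        calc (p : ℝ) ^ q * ((p : ℝ) ^ (2 * n) / D)
            ≤ (p : ℝ) ^ (ℓ + q) * ((p : ℝ) ^ (2 * n) / D) := by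
              gcongr
              omega
          _ = ε / 40 * (p : ℝ) ^ (2 * n) := by
              rw [hD]
              field_simp
  obtain ⟨ha, ha'⟩ := mul_div_bounds_of_abs_sub_le (by positivity) (hatom da)
  obtain ⟨hb, hb'⟩ := mul_div_bounds_of_abs_sub_le (by positivity) (hatom db)
  obtain ⟨hc, hc'⟩ := mul_div_bounds_of_abs_sub_le (by positivity) (hatom dc)
  obtain ⟨hab, hab'⟩ := mul_div_bounds_of_abs_sub_le (by positivity) (hfib dab)
  obtain ⟨hac, hac'⟩ := mul_div_bounds_of_abs_sub_le (by positivity) (hfib dac)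
  obtain ⟨hbc, hbc'⟩ := mul_div_bounds_of_abs_sub_le (by positivity) (hfib dbc)
  set a := ((B.atom da).ncard : ℝ) * (p : ℝ) ^ (ℓ + q) / (p : ℝ) ^ n with a_def
  set b := ((B.atom db).ncard : ℝ) * (p : ℝ) ^ (ℓ + q) / (p : ℝ) ^ n with b_def
  set c := ((B.atom dc).ncard : ℝ) * (p : ℝ) ^ (ℓ + q) / (p : ℝ) ^ n with c_def
  set u := ((B.fibQ dab).ncard : ℝ) * (p : ℝ) ^ q / (p : ℝ) ^ (2 * n) with u_def
  set v := ((B.fibQ dac).ncard : ℝ) * (p : ℝ) ^ q / (p : ℝ) ^ (2 * n) with v_def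
  set w := ((B.fibQ dbc).ncard : ℝ) * (p : ℝ) ^ q / (p : ℝ) ^ (2 * n) with w_def
  have hδ : 0 ≤ 1 - ε / 40 := by linarith
  have hclose : |(a ^ 2 * b ^ 2 * c ^ 2 * (u ^ 4 * v ^ 4 * w ^ 4))⁻¹ - 1| ≤ ε := by
    refine abs_inv_sub_one_le hε hε1 ?_ ?_
    · calc (1 - ε / 40) ^ 18 = (1 - ε / 40) ^ 2 * (1 - ε / 40) ^ 2 * (1 - ε / 40) ^ 2 *
            ((1 - ε / 40) ^ 4 * (1 - ε / 40) ^ 4 * (1 - ε / 40) ^ 4) := by ring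
        _ ≤ _ := by gcongr
    · calc _ ≤ (1 + ε / 40) ^ 2 * (1 + ε / 40) ^ 2 * (1 + ε / 40) ^ 2 *
            ((1 + ε / 40) ^ 4 * (1 + ε / 40) ^ 4 * (1 + ε / 40) ^ 4) := by
            have := hδ.trans ha
            have := hδ.trans hb
            have := hδ.trans hc
            have := hδ.trans hab
            have := hδ.trans hac
            have := hδ.trans hbc
            gcongr
        _ = _ := by ring
  rw [TW8_eq_mul_setSum]
  set S := setSum (K222 B da db dc dab dac dbc) (prod8 f)
  set P := (p : ℝ) ^ (6 * (ℓ : ℤ) + 18 * (q : ℤ) - 6 * (n : ℤ)) with P_def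
  have hP : P = (p : ℝ) ^ (6 * ℓ + 18 * q) / (p : ℝ) ^ (6 * n) := by
    rw [P_def, zpow_sub₀ hp0.ne']
    congr 1
  have hmain : ((B.atom da).ncard : ℝ)⁻¹ ^ 2 * ((B.atom db).ncard : ℝ)⁻¹ ^ 2 *
        ((B.atom dc).ncard : ℝ)⁻¹ ^ 2 *
        (((p : ℝ) ^ (2 * n) / (B.fibQ dab).ncard) ^ 4 *
          ((p : ℝ) ^ (2 * n) / (B.fibQ dac).ncard) ^ 4 *
          ((p : ℝ) ^ (2 * n) / (B.fibQ dbc).ncard) ^ 4) =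
      (a ^ 2 * b ^ 2 * c ^ 2 * (u ^ 4 * v ^ 4 * w ^ 4))⁻¹ * P := by
    rw [hP, a_def, b_def, c_def, u_def, v_def, w_def]
    simp only [mul_inv, div_eq_mul_inv, inv_pow, mul_pow, inv_inv, pow_add, pow_mul]
    have : (p : ℝ) ^ n ≠ 0 := by positivity
    have : (p : ℝ) ^ ℓ ≠ 0 := by positivity
    have : (p : ℝ) ^ q ≠ 0 := by positivity
    simp only [← pow_mul, mul_comm _ n, mul_comm _ ℓ, mul_comm _ q]
    simp only [pow_mul]
    field_simp
  rw [hmain, mul_assoc, ← sub_one_mul, abs_mul]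
  gcongr

end PaperTS
end

section
/- Let C > 1 be a real number, let k ≥ 1 be an integer, and let ρ be a growth function satisfying x ≤ ρ(x) ≤ C·x^k for all x ≥ 1. Then for all integers i ≥ 0 and all pairs (x,y) of natural numbers with y ≥ i, one has τ_i^ρ(x,y) ≤ 2^{i·k^i}·C^{i·k^i}·(x+y)^{k^i}. -/
open scoped BigOperators symmDiff
open Finset

attribute [local instance] Classical.propDecidable

namespace PaperTS

theorem tau_natCast_nonneg {ρ : ℝ → ℝ} (hρ : ∀ x, 0 ≤ ρ x) (i x : ℕ) (y : ℤ) :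
    0 ≤ tau ρ i ((x : ℤ), y) := by
  induction i with
  | zero => simp [tau]
  | succ i ih => exact add_nonneg ih (hρ _)

/-- Adding `y` to `tau` makes the polynomial bound close up under the recursion. -/
theorem tau_add_le {C : ℝ} (hC : 1 ≤ C) {k : ℕ} (hk : 1 ≤ k) {ρ : ℝ → ℝ}
    (hρ : GrowthFunction ρ) (hbound : ∀ x : ℝ, 1 ≤ x → ρ x ≤ C * x ^ k)
    (i x y : ℕ) (hi : i ≤ y) :
    tau ρ i ((x : ℤ), (y : ℤ)) + y ≤ (2 * C) ^ (i * k ^ i) * ((x : ℝ) + y) ^ (k ^ i) := by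
  induction i with
  | zero => simp [tau]
  | succ i ih =>
    have hτ := tau_natCast_nonneg hρ.2 i x y
    have hy : (1 : ℝ) ≤ y := by exact_mod_cast (Nat.succ_pos i).trans_le hi
    have ih := ih (Nat.le_of_succ_le hi)
    simp only [tau, Int.cast_natCast]
    set t := tau ρ i ((x : ℤ), (y : ℤ))
    have ht : 1 ≤ t + y := by linarith
    have hstep : ρ (t + y - i) ≤ C * (t + y) ^ k :=
      (hρ.1 (sub_le_self _ (Nat.cast_nonneg i))).trans (hbound _ ht)
    have hself : t + y ≤ C * (t + y) ^ k :=
      (le_self_pow₀ ht (by omega)).trans (le_mul_of_one_le_left (by positivity) hC)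
    have hexp : 1 + i * k ^ i * k ≤ (i + 1) * k ^ (i + 1) := by
      have := Nat.one_le_pow (i + 1) k hk
      rw [mul_assoc, ← pow_succ]
      linarith
    calc t + ρ (t + y - i) + y ≤ 2 * C * (t + y) ^ k := by linarith
      _ ≤ 2 * C * ((2 * C) ^ (i * k ^ i) * ((x : ℝ) + y) ^ (k ^ i)) ^ k := by gcongr
      _ = (2 * C) ^ (1 + i * k ^ i * k) * ((x : ℝ) + y) ^ (k ^ (i + 1)) := by
        rw [mul_pow, ← pow_mul, ← pow_mul, pow_succ k, pow_add (2 * C), pow_one, mul_assoc (2 * C)]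
      _ ≤ (2 * C) ^ ((i + 1) * k ^ (i + 1)) * ((x : ℝ) + y) ^ (k ^ (i + 1)) := by
        gcongr
        linarith

theorem statement15 (C : ℝ) (hC : 1 < C) (k : ℕ) (hk : 1 ≤ k)
    (ρ : ℝ → ℝ) (hρ : GrowthFunction ρ)
    (hbounds : ∀ x : ℝ, 1 ≤ x → x ≤ ρ x ∧ ρ x ≤ C * x ^ k) :
    ∀ (i x y : ℕ), i ≤ y →
      tau ρ i ((x : ℤ), (y : ℤ)) ≤
        2 ^ (i * k ^ i) * C ^ (i * k ^ i) * ((x : ℝ) + (y : ℝ)) ^ (k ^ i) := by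
  intro i x y hi
  rw [← mul_pow]
  have h := tau_add_le hC.le hk hρ (fun z hz => (hbounds z hz).2) i x y hi
  linarith [(Nat.cast_nonneg y : (0 : ℝ) ≤ y)]

end PaperTS
end

section
/- Let ρ be a growth function and let m ≥ 2 be an integer. Suppose σ = (σ_1,…,σ_m) ∈ {−1,1}^m is such that for some 1 ≤ i ≤ m−1, σ_i = −1 and σ_{i+1} = 1. Let φ = (φ_1,…,φ_m) ∈ {−1,1}^m be defined by φ_i = 1, φ_{i+1} = −1, and φ_j = σ_j for all j ∈ [m]∖{i,i+1}. Writing f_σ^ρ = (a_σ, b_σ) and f_φ^ρ = (a_φ, b_φ), one has a_σ ≤ a_φ and b_σ = b_φ. -/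
open scoped BigOperators symmDiff
open Finset

attribute [local instance] Classical.propDecidable

namespace PaperTS

/-- Appending the same final symbol to two strings preserves `≤` in the first coordinate together
with equality in the second. -/
theorem fseq_succ_le {ρ : ℝ → ℝ} (hρ : Monotone ρ) {m : ℕ} {σ φ : Fin (m + 1) → ℤ}
    (hlast : φ (Fin.last m) = σ (Fin.last m))
    (h₁ : (fseq ρ m fun j => σ j.castSucc).1 ≤ (fseq ρ m fun j => φ j.castSucc).1)
    (h₂ : (fseq ρ m fun j => σ j.castSucc).2 = (fseq ρ m fun j => φ j.castSucc).2) :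
    (fseq ρ (m + 1) σ).1 ≤ (fseq ρ (m + 1) φ).1 ∧
      (fseq ρ (m + 1) σ).2 = (fseq ρ (m + 1) φ).2 := by
  simp only [fseq, hlast]
  split_ifs
  · exact ⟨by linarith, by rw [h₂]⟩
  · exact ⟨add_le_add h₁ (hρ (by linarith)), by rw [h₂]⟩

/-- Replacing a final `(-1, 1)` by `(1, -1)` does not decrease the first coordinate of `fseq` and
preserves the second. -/
theorem fseq_swap_last_le {ρ : ℝ → ℝ} (hρ : Monotone ρ) {m : ℕ} {σ φ : Fin (m + 2) → ℤ}
    (hinit : ∀ j : Fin m, φ j.castSucc.castSucc = σ j.castSucc.castSucc)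
    (hσ₁ : σ (Fin.last m).castSucc = -1) (hσ₂ : σ (Fin.last (m + 1)) = 1)
    (hφ₁ : φ (Fin.last m).castSucc = 1) (hφ₂ : φ (Fin.last (m + 1)) = -1) :
    (fseq ρ (m + 2) σ).1 ≤ (fseq ρ (m + 2) φ).1 ∧
      (fseq ρ (m + 2) σ).2 = (fseq ρ (m + 2) φ).2 := by
  have h : ¬ (-1 : ℤ) = 1 := by decide
  simp only [fseq, hσ₁, hσ₂, hφ₁, hφ₂, hinit, if_neg h, if_true]
  set a := (fseq ρ m fun j => σ j.castSucc.castSucc).1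
  set b := (fseq ρ m fun j => σ j.castSucc.castSucc).2
  have := hρ (show a + b ≤ a + 1 + (b + 1) by linarith)
  exact ⟨by linarith, by ring⟩

/-- Replacing consecutive symbols `(-1, 1)` by `(1, -1)` does not decrease the first coordinate of
`fseq` and preserves the second. -/
theorem fseq_swap_le {ρ : ℝ → ℝ} (hρ : Monotone ρ) {m k : ℕ} (hk : k + 1 < m)
    {σ φ : Fin m → ℤ}
    (hσ₁ : σ ⟨k, by omega⟩ = -1) (hσ₂ : σ ⟨k + 1, hk⟩ = 1)
    (hφ₁ : φ ⟨k, by omega⟩ = 1) (hφ₂ : φ ⟨k + 1, hk⟩ = -1)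
    (hother : ∀ j : Fin m, (j : ℕ) ≠ k → (j : ℕ) ≠ k + 1 → φ j = σ j) :
    (fseq ρ m σ).1 ≤ (fseq ρ m φ).1 ∧ (fseq ρ m σ).2 = (fseq ρ m φ).2 := by
  induction m with
  | zero => omega
  | succ m ih =>
    rcases (Nat.lt_succ_iff.mp hk).lt_or_eq with hlt | rfl
    · obtain ⟨h₁, h₂⟩ := ih (σ := fun j => σ j.castSucc) (φ := fun j => φ j.castSucc) hlt
        hσ₁ hσ₂ hφ₁ hφ₂ fun j => hother j.castSucc
      exact fseq_succ_le hρ (hother _ (by simp; omega) (by simp; omega)) h₁ h₂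
    · exact fseq_swap_last_le hρ
        (fun j => hother _ (by simp; omega) (by simp; omega)) hσ₁ hσ₂ hφ₁ hφ₂

theorem statement16 (ρ : ℝ → ℝ) (hρ : GrowthFunction ρ) (m : ℕ) (hm : 2 ≤ m)
    (σ : Fin m → ℤ) (hσ : ∀ j, σ j = 1 ∨ σ j = -1)
    (i : Fin m) (hi : (i : ℕ) + 1 < m)
    (hσi : σ i = -1) (hσisucc : σ ⟨(i : ℕ) + 1, hi⟩ = 1)
    (φ : Fin m → ℤ)
    (hφ : ∀ j : Fin m,
      φ j = if j = i then 1 else if j = ⟨(i : ℕ) + 1, hi⟩ then -1 else σ j) :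
    (fseq ρ m σ).1 ≤ (fseq ρ m φ).1 ∧ (fseq ρ m σ).2 = (fseq ρ m φ).2 := by
  refine fseq_swap_le hρ.1 hi hσi hσisucc (by simp [hφ]) (by simp [hφ, Fin.ext_iff]) ?_
  intro j h₁ h₂
  rw [hφ, if_neg (by simpa [Fin.ext_iff] using h₁), if_neg (by simpa [Fin.ext_iff] using h₂)]

end PaperTS
end
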